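/- arXiv:1809.09471 — 2 statements merged into one kernel-verified Lean document; each statement's English description precedes it below -/
import Mathlib

section
/- Let d ≥ 1 and let Ω ⊆ ℝ^d be a convex body. Then the flag approximability satisfies a_f(Ω) ≤ (d−1)/2. -/
open Filter Set MeasureTheory Metric
open scoped ENNReal Topology Pointwise RealInnerProductSpace

noncomputable section
open scoped Classical

abbrev Euc (d : ℕ) := EuclideanSpace ℝ (Fin d)

/-- The Hilbert distance on a bounded open convex set `U`. -/
def hilbertDist {d : ℕ} (U : Set (Euc d)) (p q : Euc d) : ℝ :=
  if p = q then 0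
  else
    (1 / 2) * Real.log
      (((1 - sInf {t : ℝ | p + t • (q - p) ∈ U}) / (- sInf {t : ℝ | p + t • (q - p) ∈ U})) *
        (sSup {t : ℝ | p + t • (q - p) ∈ U} / (sSup {t : ℝ | p + t • (q - p) ∈ U} - 1)))

/-- The closed Hilbert ball. -/
def hilbertBall {d : ℕ} (U : Set (Euc d)) (p : Euc d) (R : ℝ) : Set (Euc d) :=
  {q ∈ U | hilbertDist U p q ≤ R}

/-- The Finsler (Hilbert) norm `F_U(p, v)`. -/
def finslerNorm {d : ℕ} (U : Set (Euc d)) (p v : Euc d) : ℝ :=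
  if v = 0 then 0
  else (1 / 2) * (1 / sSup {t : ℝ | 0 < t ∧ p + t • v ∈ U}
                + 1 / sSup {t : ℝ | 0 < t ∧ p - t • v ∈ U})

/-- The unit ball `β_U(p)` of the Finsler norm. -/
def finslerUnitBall {d : ℕ} (U : Set (Euc d)) (p : Euc d) : Set (Euc d) :=
  {v | finslerNorm U p v < 1}

/-- The Busemann volume of `A ⊆ U`. -/
def busemannVol {d : ℕ} (U : Set (Euc d)) (A : Set (Euc d)) : ℝ≥0∞ :=
  ∫⁻ p in A, volume (Metric.ball (0 : Euc d) 1) / volume (finslerUnitBall U p)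

/-- The polar body `K°`. -/
def polarSet {d : ℕ} (K : Set (Euc d)) : Set (Euc d) :=
  {y | ∀ v ∈ K, ⟪v, y⟫ ≤ (1 : ℝ)}

/-- The Holmes–Thompson volume of `A ⊆ U`. -/
def htVol {d : ℕ} (U : Set (Euc d)) (A : Set (Euc d)) : ℝ≥0∞ :=
  ∫⁻ p in A, volume (polarSet (finslerUnitBall U p)) / volume (Metric.ball (0 : Euc d) 1)

/-- The asymptotic ball `AsB_U(y, R)`. -/
def asympBall {d : ℕ} (U : Set (Euc d)) (y : Euc d) (R : ℝ) : Set (Euc d) :=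
  if 0 < R then (fun u => y + (1 - Real.exp (-2 * R)) • (u - y)) '' U else ∅

/-- `F` is a face of the compact convex set `P`. -/
def IsFace {d : ℕ} (P F : Set (Euc d)) : Prop :=
  F.Nonempty ∧ IsClosed F ∧ Convex ℝ F ∧ IsExtreme ℝ P F

/-- The dimension of a set: the dimension of its affine span. -/
def faceDim {d : ℕ} (F : Set (Euc d)) : ℕ :=
  Module.finrank ℝ (affineSpan ℝ F).direction

/-- The set of maximal flags of a `dm`-dimensional polytope `P ⊆ ℝ^d`. -/
def flagSet {d : ℕ} (dm : ℕ) (P : Set (Euc d)) : Set (Fin (dm + 1) → Set (Euc d)) :=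
  {f | (∀ i, IsFace P (f i) ∧ faceDim (f i) = (i : ℕ)) ∧
       ∀ i j : Fin (dm + 1), i ≤ j → f i ⊆ f j}

/-- `N(ε, Ω)`: the least number of maximal flags of a `d`-dimensional polytope within
Hausdorff distance `ε` of `Ω`. -/
def flagNumber (d : ℕ) (Ω : Set (Euc d)) (ε : ℝ) : ℕ :=
  sInf {n | ∃ V : Finset (Euc d), V.Nonempty ∧
    faceDim (convexHull ℝ (V : Set (Euc d))) = d ∧
    Metric.hausdorffDist (convexHull ℝ (V : Set (Euc d))) Ω ≤ ε ∧
    (flagSet d (convexHull ℝ (V : Set (Euc d)))).ncard = n}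

/-- The flag approximability `a_f(Ω)`. -/
def flagApprox (d : ℕ) (Ω : Set (Euc d)) : ℝ :=
  liminf (fun ε : ℝ => Real.log (flagNumber d Ω ε) / (- Real.log ε)) (𝓝[>] 0)

/-- `s` is a `dm`-simplex. -/
def IsSimplexSet {d : ℕ} (dm : ℕ) (s : Set (Euc d)) : Prop :=
  ∃ v : Fin (dm + 1) → Euc d, AffineIndependent ℝ v ∧ s = convexHull ℝ (Set.range v)

/-- `S` is a flag simplex of the `dm`-dimensional polytope `P`. -/
def IsFlagSimplex {d : ℕ} (dm : ℕ) (P S : Set (Euc d)) : Prop :=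
  ∃ f ∈ flagSet dm P, ∃ v : Fin (dm + 1) → Euc d, AffineIndependent ℝ v ∧
    S = convexHull ℝ (Set.range v) ∧ ∀ i, v i ∈ intrinsicInterior ℝ (f i)

/-- The Macbeath region `M'(x)`. -/
def macbeath {d : ℕ} (Ω : Set (Euc d)) (x : Euc d) : Set (Euc d) :=
  (fun v => x + v) ''
    (((5 : ℝ)⁻¹ • ((fun w => w - x) '' Ω)) ∩ ((5 : ℝ)⁻¹ • ((fun w => x - w) '' Ω)))

/-- The Funk distance with respect to the convex body `Ω`. -/
def funkDist {d : ℕ} (Ω : Set (Euc d)) (p q : Euc d) : ℝ :=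
  if p = q then 0
  else Real.log (sSup {t : ℝ | p + t • (q - p) ∈ Ω} /
        (sSup {t : ℝ | p + t • (q - p) ∈ Ω} - 1))

section PartA
variable {d : ℕ}

lemma fa_isCompact_hull (V : Finset (Euc d)) : IsCompact (convexHull ℝ (V : Set (Euc d))) :=
  V.finite_toSet.isCompact_convexHull (𝕜 := ℝ)

lemma fa_face_eq (V : Finset (Euc d)) {F : Set (Euc d)}
    (hF : IsFace (convexHull ℝ (V : Set (Euc d))) F) :
    F = convexHull ℝ ((V : Set (Euc d)) ∩ F) := by
  obtain ⟨-, hcl, hcv, hex⟩ := hF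
  have hc : IsCompact F := (fa_isCompact_hull V).of_isClosed_subset hcl hex.1
  apply Subset.antisymm
  · conv_lhs => rw [← closure_convexHull_extremePoints hc hcv]
    have hsub : F.extremePoints ℝ ⊆ (V : Set (Euc d)) ∩ F := fun x hx =>
      ⟨extremePoints_convexHull_subset (hex.extremePoints_subset_extremePoints hx), hx.1⟩
    apply closure_minimal (convexHull_mono hsub)
    exact ((V.finite_toSet.inter_of_left F).isCompact_convexHull (𝕜 := ℝ)).isClosed
  · exact convexHull_min inter_subset_right hcv

lemma fa_mem_of_span {P F : Set (Euc d)} (hF : IsFace P F) {x : Euc d} (hx : x ∈ P)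
    (hxs : x ∈ affineSpan ℝ F) : x ∈ F := by
  obtain ⟨hne, hcl, hcv, hex⟩ := hF
  obtain ⟨y, hy⟩ := hne.intrinsicInterior hcv
  obtain ⟨y', hy', rfl⟩ := mem_intrinsicInterior.1 hy
  let x' : affineSpan ℝ F := ⟨x, hxs⟩
  let g : ℝ → Euc d := fun t => AffineMap.lineMap (y' : Euc d) x (-t)
  have hg : ∀ t, g t ∈ affineSpan ℝ F := fun t =>
    AffineMap.lineMap_mem _ y'.2 hxs
  let g' : ℝ → affineSpan ℝ F := fun t => ⟨g t, hg t⟩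
  have hgc : Continuous g := by
    simp only [g, AffineMap.lineMap_apply]
    fun_prop
  have hg'c : Continuous g' := hgc.subtype_mk _
  have h0 : g' 0 = y' := by
    apply Subtype.ext
    simp [g', g]
  have hev : ∀ᶠ t in 𝓝 (0 : ℝ), g' t ∈ ((↑) ⁻¹' F : Set (affineSpan ℝ F)) := by
    apply hg'c.continuousAt
    rw [h0]
    exact mem_interior_iff_mem_nhds.1 hy'
  obtain ⟨t, ht, htpos⟩ := ((hev.filter_mono nhdsWithin_le_nhds).and
    (self_mem_nhdsWithin : ∀ᶠ t in 𝓝[>] (0 : ℝ), t ∈ Ioi (0 : ℝ))).exists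
  have htF : g t ∈ F := ht
  have htpos : 0 < t := htpos
  have hyF : (y' : Euc d) ∈ F := by
    have := interior_subset hy'
    exact this
  refine hex.2 hx (hex.1 htF) hyF ?_
  refine ⟨t / (1 + t), 1 / (1 + t), by positivity, by positivity, by field_simp; ring, ?_⟩
  simp only [g, AffineMap.lineMap_apply, vsub_eq_sub, vadd_eq_add]
  have h1 : (1 + t) ≠ 0 := by positivity
  have : (1 / (1 + t)) • (-t • (x - (y' : Euc d)) + y') =
    (-(t / (1 + t))) • x + ((1 + t) / (1 + t)) • (y' : Euc d) := by
    module
  rw [this, div_self h1]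
  module

lemma fa_affineSpan_top {P : Set (Euc d)} (hne : P.Nonempty) (h : faceDim P = d) :
    affineSpan ℝ P = ⊤ := by
  have : (affineSpan ℝ P).direction = ⊤ := by
    apply Submodule.eq_top_of_finrank_eq
    rw [finrank_euclideanSpace_fin]
    exact h
  rw [← AffineSubspace.direction_eq_top_iff_of_nonempty]
  · exact this
  · exact (affineSpan_nonempty ℝ).2 hne

lemma fa_support {P F : Set (Euc d)} (hP : Convex ℝ P) (hdim : faceDim P = d)
    (hF : IsFace P F) (hFd : faceDim F < d) :
    ∃ u : Euc d, ‖u‖ = 1 ∧ ∀ z ∈ F, ∀ y ∈ P, ⟪u, y⟫ ≤ ⟪u, z⟫ := by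
  have hPne : P.Nonempty := hF.1.mono hF.2.2.2.1
  have hint : (interior P).Nonempty := by
    rw [hP.interior_nonempty_iff_affineSpan_eq_top]
    exact fa_affineSpan_top hPne hdim
  have hdisj : Disjoint (interior P) F := by
    rw [Set.disjoint_left]
    intro z hz hzF
    have : P ⊆ F := by
      intro y hy
      have hev : ∀ᶠ t in 𝓝 (0 : ℝ), z + t • (z - y) ∈ P := by
        have hc : ContinuousAt (fun t : ℝ => z + t • (z - y)) 0 := by fun_prop
        apply hc
        simpa using mem_interior_iff_mem_nhds.1 hz
      obtain ⟨t, ht, htpos⟩ := ((hev.filter_mono nhdsWithin_le_nhds).and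
        (self_mem_nhdsWithin : ∀ᶠ t in 𝓝[>] (0 : ℝ), t ∈ Ioi (0 : ℝ))).exists
      have htpos : 0 < t := htpos
      refine hF.2.2.2.2 hy ht hzF ?_
      refine ⟨t / (1 + t), 1 / (1 + t), by positivity, by positivity, by field_simp; ring, ?_⟩
      have h1 : (1 + t) ≠ 0 := by positivity
      have : (t / (1 + t)) • y + (1 / (1 + t)) • (z + t • (z - y)) =
        ((1 + t) / (1 + t)) • z := by
        module
      rw [this, div_self h1, one_smul]
    have heq : F = P := Subset.antisymm hF.2.2.2.1 this
    rw [heq, hdim] at hFd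
    exact lt_irrefl _ hFd
  obtain ⟨f, c, hfc, hcf⟩ := geometric_hahn_banach_open hP.interior isOpen_interior
    hF.2.2.1 hdisj
  have hle : ∀ y ∈ P, f y ≤ c := by
    have hcl : P ⊆ closure (interior P) := by
      rw [hP.closure_interior_eq_closure_of_nonempty_interior hint]
      exact subset_closure
    intro y hy
    have : closure (interior P) ⊆ {y | f y ≤ c} :=
      closure_minimal (fun a ha => (hfc a ha).le) (isClosed_le f.continuous continuous_const)
    exact this (hcl hy)
  set g := (InnerProductSpace.toDual ℝ (Euc d)).symm f with hg
  have hgf : ∀ y, ⟪g, y⟫ = f y := fun y => InnerProductSpace.toDual_symm_apply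
  have hg0 : g ≠ 0 := by
    intro h0
    obtain ⟨a, ha⟩ := hint
    obtain ⟨b, hb⟩ := hF.1
    have h1 := hfc a ha
    have h2 := hcf b hb
    rw [← hgf, h0, inner_zero_left] at h1 h2
    linarith
  refine ⟨‖g‖⁻¹ • g, by
    rw [norm_smul, norm_inv, norm_norm, inv_mul_cancel₀ (norm_ne_zero_iff.2 hg0)], ?_⟩
  intro z hz y hy
  rw [real_inner_smul_left, real_inner_smul_left, hgf, hgf]
  exact mul_le_mul_of_nonneg_left ((hle y hy).trans (hcf z hz)) (by positivity)

end PartA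

section PartA2
variable {d : ℕ}

/-- The candidate flag spanned by a sequence of vertices. -/
def faChain (P : Set (Euc d)) (v : Fin d → Euc d) : Fin (d + 1) → Set (Euc d) :=
  fun k => if k.val = d then P else
    P ∩ (affineSpan ℝ (v '' {j | j.val ≤ k.val}) : Set (Euc d))

lemma fa_flag_repr (V : Finset (Euc d)) (hdim : faceDim (convexHull ℝ (V : Set (Euc d))) = d)
    {f : Fin (d + 1) → Set (Euc d)} (hf : f ∈ flagSet d (convexHull ℝ (V : Set (Euc d)))) :
    ∃ v : Fin d → Euc d, (∀ k, v k ∈ V ∧ v k ∈ f k.castSucc) ∧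
      f = faChain (convexHull ℝ (V : Set (Euc d))) v := by
  obtain ⟨hface, hmono⟩ := hf
  set P := convexHull ℝ (V : Set (Euc d)) with hP
  have hspan : ∀ k, affineSpan ℝ (f k) = affineSpan ℝ ((V : Set (Euc d)) ∩ f k) := by
    intro k
    conv_lhs => rw [fa_face_eq V (hface k).1]
    exact affineSpan_convexHull _
  have hex : ∀ k : Fin d, ∃ v ∈ V, v ∈ f k.castSucc ∧
      ∀ j : Fin (d + 1), j < k.castSucc → v ∉ affineSpan ℝ (f j) := by
    intro k
    by_contra hcon
    push Not at hcon
    have hne := (hface k.castSucc).1.1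
    rw [fa_face_eq V (hface k.castSucc).1, convexHull_nonempty_iff] at hne
    obtain ⟨z, hzV, hzf⟩ := hne
    obtain ⟨j, hj, -⟩ := hcon z hzV hzf
    have hk : 0 < k.val := by
      have : j.val < k.val := hj
      omega
    let k' : Fin (d + 1) := ⟨k.val - 1, by omega⟩
    have hsub : affineSpan ℝ (f k.castSucc) ≤ affineSpan ℝ (f k') := by
      rw [hspan k.castSucc, affineSpan_le]
      rintro z ⟨hzV, hzf⟩
      obtain ⟨j, hj, hzj⟩ := hcon z hzV hzf
      have hjk : j ≤ k' := by
        have : j.val < k.val := hj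
        show j.val ≤ k.val - 1
        omega
      exact affineSpan_mono ℝ (hmono _ _ hjk) hzj
    have h1 := Submodule.finrank_mono (AffineSubspace.direction_le hsub)
    have h2 := (hface k.castSucc).2
    have h3 := (hface k').2
    unfold faceDim at h2 h3
    rw [h2, h3] at h1
    simp [k'] at h1
    omega
  choose v hvV hvf hvn using hex
  refine ⟨v, fun k => ⟨hvV k, hvf k⟩, ?_⟩
  have hle : ∀ n (hn : n < d), affineSpan ℝ (v '' {j | j.val ≤ n}) ≤
      affineSpan ℝ (f ⟨n, by omega⟩) := by
    intro n hn
    apply affineSpan_mono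
    rintro _ ⟨j, hj, rfl⟩
    exact hmono _ _ (show j.castSucc ≤ (⟨n, by omega⟩ : Fin (d + 1)) from hj) (hvf j)
  have key : ∀ n (hn : n < d), affineSpan ℝ (v '' {j | j.val ≤ n}) =
      affineSpan ℝ (f ⟨n, by omega⟩) := by
    intro n
    induction n with
    | zero =>
      intro hn
      have hne : (affineSpan ℝ (v '' {j | j.val ≤ 0}) : Set (Euc d)).Nonempty := by
        rw [affineSpan_nonempty]
        exact ⟨v ⟨0, hn⟩, ⟨0, hn⟩, by simp, rfl⟩
      refine AffineSubspace.eq_of_direction_eq_of_nonempty_of_le ?_ hne (hle 0 hn)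
      apply Submodule.eq_of_le_of_finrank_le (AffineSubspace.direction_le (hle 0 hn))
      have h3 := (hface ⟨0, by omega⟩).2
      unfold faceDim at h3
      rw [h3]
      exact Nat.zero_le _
    | succ n ih =>
      intro hn
      have hne : (affineSpan ℝ (v '' {j | j.val ≤ n + 1}) : Set (Euc d)).Nonempty := by
        rw [affineSpan_nonempty]
        exact ⟨v ⟨0, by omega⟩, ⟨0, by omega⟩, by simp, rfl⟩
      refine AffineSubspace.eq_of_direction_eq_of_nonempty_of_le ?_ hne (hle (n + 1) hn)
      apply Submodule.eq_of_le_of_finrank_le (AffineSubspace.direction_le (hle (n + 1) hn))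
      have h3 := (hface ⟨n + 1, by omega⟩).2
      have h4 := (hface ⟨n, by omega⟩).2
      unfold faceDim at h3 h4
      rw [h3]
      have hlt : affineSpan ℝ (f ⟨n, by omega⟩) < affineSpan ℝ (v '' {j | j.val ≤ n + 1}) := by
        refine lt_of_le_of_ne ?_ ?_
        · rw [← ih (by omega)]
          apply affineSpan_mono
          apply image_mono
          intro j hj
          exact Nat.le_succ_of_le hj
        · intro heq
          refine hvn ⟨n + 1, hn⟩ ⟨n, by omega⟩ (show n < n + 1 by omega) ?_
          rw [heq]
          exact mem_affineSpan ℝ ⟨⟨n + 1, hn⟩, by simp, rfl⟩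
      have h5 := Submodule.finrank_lt_finrank_of_lt (AffineSubspace.direction_lt_of_nonempty hlt
        ((affineSpan_nonempty ℝ).2 (hface ⟨n, by omega⟩).1.1))
      rw [h4] at h5
      exact h5
  funext k
  unfold faChain
  split_ifs with hk
  · refine Subset.antisymm (hface k).1.2.2.2.1 ?_
    intro x hx
    refine fa_mem_of_span (hface k).1 hx ?_
    rw [fa_affineSpan_top (hface k).1.1 ((hface k).2.trans hk)]
    trivial
  · have hkd : k.val < d := by omega
    rw [key k.val hkd]
    refine Subset.antisymm (fun x hx => ⟨(hface k).1.2.2.2.1 hx, mem_affineSpan ℝ hx⟩) ?_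
    rintro x ⟨hx, hxs⟩
    exact fa_mem_of_span (hface k).1 hx hxs

lemma fa_flag_card (hd : 1 ≤ d) (V : Finset (Euc d))
    (hdim : faceDim (convexHull ℝ (V : Set (Euc d))) = d)
    {ι : Type*} (I : Finset ι) (B : ι → Finset (Euc d)) (n : ℕ)
    (hB : ∀ i ∈ I, (B i).card ≤ n)
    (hcover : ∀ u : Euc d, ‖u‖ = 1 → ∃ i ∈ I, ∀ z ∈ V,
      (∀ y ∈ V, ⟪u, y⟫ ≤ ⟪u, z⟫) → z ∈ B i) :
    (flagSet d (convexHull ℝ (V : Set (Euc d)))).ncard ≤ I.card * n ^ d := by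
  set P := convexHull ℝ (V : Set (Euc d)) with hP
  let T : Finset (Fin (d + 1) → Set (Euc d)) :=
    I.biUnion fun i => (Fintype.piFinset fun _ : Fin d => B i).image (faChain P)
  have hsub : flagSet d P ⊆ (T : Set (Fin (d + 1) → Set (Euc d))) := by
    intro f hf
    obtain ⟨v, hv, hfv⟩ := fa_flag_repr V hdim hf
    let k0 : Fin (d + 1) := ⟨d - 1, by omega⟩
    have hk0 := hf.1 k0
    obtain ⟨u, hu, hsup⟩ := fa_support (convex_convexHull ℝ _) hdim hk0.1 (by
      rw [hk0.2]; show d - 1 < d; omega)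
    obtain ⟨i, hi, hiB⟩ := hcover u hu
    rw [Finset.mem_coe, Finset.mem_biUnion]
    refine ⟨i, hi, ?_⟩
    rw [Finset.mem_image]
    refine ⟨v, ?_, hfv.symm⟩
    rw [Fintype.mem_piFinset]
    intro k
    refine hiB _ (hv k).1 ?_
    intro y hy
    refine hsup _ (hf.2 k.castSucc k0 (show k.val ≤ d - 1 by omega) (hv k).2) y ?_
    exact subset_convexHull ℝ _ hy
  calc (flagSet d P).ncard ≤ (T : Set (Fin (d + 1) → Set (Euc d))).ncard :=
        Set.ncard_le_ncard hsub T.finite_toSet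
    _ = T.card := Set.ncard_coe_finset T
    _ ≤ I.card * n ^ d := by
        apply Finset.card_biUnion_le_card_mul
        intro i hi
        refine Finset.card_image_le.trans ?_
        rw [Fintype.card_piFinset]
        simp only [Finset.prod_const, Finset.card_univ, Fintype.card_fin]
        exact Nat.pow_le_pow_left (hB i hi) d

end PartA2

section PartJ
variable {d : ℕ}

/-- A rough John position: an affine ellipsoid inside `C` whose `K`-dilate covers `C`. -/
structure IsChart (C : Set (Euc d)) (K : ℝ) (x : Euc d) (A : Euc d →ₗ[ℝ] Euc d) : Prop where
  det_ne : LinearMap.det A ≠ 0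
  inner : ∀ v, ‖v‖ ≤ 1 → x + A v ∈ C
  outer : ∀ y ∈ C, ∃ v, ‖v‖ ≤ K ∧ y = x + A v

lemma fa_john (C : Set (Euc d)) (hC : IsCompact C) (hcv : Convex ℝ C)
    (hint : (interior C).Nonempty) :
    ∃ x A, IsChart C (2 * ((d : ℝ) + 1) ^ 3) x A := by
  let e : Module.Basis (Fin d) ℝ (Euc d) := (EuclideanSpace.basisFun (Fin d) ℝ).toBasis
  let φ : Euc d × (Fin d → Euc d) → ℝ := fun a => |e.det (fun i => a.2 i - a.1)|
  have hφ : Continuous φ := by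
    apply Continuous.abs
    have : (fun a : Euc d × (Fin d → Euc d) => e.det (fun i => a.2 i - a.1)) =
        fun a => Matrix.det (Matrix.of fun i j => (a.2 j - a.1) i) := by
      funext a
      rw [Module.Basis.det_apply]
      congr 1
    rw [this]
    apply Continuous.matrix_det
    apply continuous_pi
    intro i
    apply continuous_pi
    intro j
    simp only [Matrix.of_apply]
    fun_prop
  have hcomp : IsCompact (C ×ˢ (Set.univ.pi fun _ : Fin d => C)) :=
    hC.prod (isCompact_univ_pi fun _ => hC)
  obtain ⟨y0, hy0⟩ := hint
  have hne : (C ×ˢ (Set.univ.pi fun _ : Fin d => C)).Nonempty :=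
    ⟨(y0, fun _ => y0), interior_subset hy0, fun _ _ => interior_subset hy0⟩
  obtain ⟨a, ⟨ha0, ha⟩, hmax⟩ := hcomp.exists_isMaxOn hne hφ.continuousOn
  have ha : ∀ i, a.2 i ∈ C := fun i => ha i trivial
  set b : Fin d → Euc d := fun i => a.2 i - a.1 with hb
  have hdet : e.det b ≠ 0 := by
    obtain ⟨ρ, hρ, hball⟩ := Metric.isOpen_iff.1 isOpen_interior y0 hy0
    have hmem : ∀ i, y0 + (ρ / 2) • e i ∈ C := by
      intro i
      apply interior_subset (hball _)
      rw [mem_ball, dist_eq_norm, add_sub_cancel_left, norm_smul]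
      have : ‖e i‖ = 1 := by simp [e]
      rw [this, Real.norm_of_nonneg (by positivity)]
      linarith
    have h1 := hmax (show (y0, fun i => y0 + (ρ / 2) • e i) ∈
      C ×ˢ (Set.univ.pi fun _ : Fin d => C) from ⟨interior_subset hy0, fun i _ => hmem i⟩)
    have h2 : φ (y0, fun i => y0 + (ρ / 2) • e i) = (ρ / 2) ^ d := by
      simp only [φ, add_sub_cancel_left]
      rw [AlternatingMap.map_smul_univ (e.det) (fun _ => ρ / 2) (fun i => e i)]
      have : e.det (fun i => e i) = 1 := e.det_self
      rw [this]
      simp only [Finset.prod_const, Finset.card_univ, Fintype.card_fin, smul_eq_mul, mul_one]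
      exact abs_of_pos (by positivity)
    intro h0
    have h3 : φ a = 0 := by simp only [φ]; rw [h0, abs_zero]
    have h4 : φ (y0, fun i => y0 + (ρ / 2) • e i) ≤ φ a := h1
    rw [h2, h3] at h4
    have : 0 < (ρ / 2) ^ d := by positivity
    linarith
  obtain ⟨hli, hsp⟩ := (Module.Basis.is_basis_iff_det e).2 (isUnit_iff_ne_zero.2 hdet)
  let bb : Module.Basis (Fin d) ℝ (Euc d) := Module.Basis.mk hli hsp.ge
  have hbb : ∀ i, bb i = b i := fun i => Module.Basis.mk_apply hli hsp.ge i
  have hcoord : ∀ y ∈ C, ∀ i, |bb.coord i (y - a.1)| ≤ 1 := by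
    intro y hy i
    have h1 := congrArg (fun l => l (y - a.1)) (e.det_smul_mk_coord_eq_det_update hli hsp.ge i)
    simp only [LinearMap.smul_apply, smul_eq_mul, MultilinearMap.toLinearMap_apply] at h1
    have h2 : (Function.update b i (y - a.1)) = fun j => (Function.update a.2 i y) j - a.1 := by
      funext j
      by_cases hj : j = i
      · subst hj; simp
      · simp [hj, hb]
    have h3 := hmax (show (a.1, Function.update a.2 i y) ∈
      C ×ˢ (Set.univ.pi fun _ : Fin d => C) from ⟨ha0, fun j _ => by
        by_cases hj : j = i
        · subst hj; simpa using hy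
        · simpa [hj] using ha j⟩)
    have h4 : φ (a.1, Function.update a.2 i y) ≤ φ a := h3
    have h5 : φ (a.1, Function.update a.2 i y) = |e.det b| * |bb.coord i (y - a.1)| := by
      rw [← abs_mul]
      simp only [φ]
      rw [← h2]
      exact congrArg abs h1.symm
    rw [h5] at h4
    have h6 : φ a = |e.det b| := rfl
    rw [h6] at h4
    have h7 : 0 < |e.det b| := abs_pos.2 hdet
    by_contra hcon
    push Not at hcon
    nlinarith
  set D : ℝ := (d : ℝ) + 1 with hD
  have hDpos : 0 < D := by positivity
  have hD1 : 1 ≤ D := by simp [hD]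
  let A0 : Euc d ≃ₗ[ℝ] Euc d := e.equiv bb (Equiv.refl _)
  have hA0 : ∀ v : Euc d, A0 v = ∑ i, v i • b i := by
    intro v
    have : v = ∑ i, v i • e i := by
      conv_lhs => rw [← e.sum_repr v]
      rfl
    conv_lhs => rw [this]
    rw [map_sum]
    refine Finset.sum_congr rfl fun i _ => ?_
    rw [map_smul]
    congr 1
    simp only [A0, Module.Basis.equiv_apply, Equiv.refl_apply]
    exact hbb i
  let x : Euc d := a.1 + ∑ i, (1 / D) • b i
  refine ⟨x, (1 / D ^ 2) • (A0 : Euc d →ₗ[ℝ] Euc d), ?_, ?_, ?_⟩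
  · rw [LinearMap.det_smul]
    exact mul_ne_zero (by positivity) (LinearEquiv.isUnit_det' A0).ne_zero
  · intro v hv
    have hvi : ∀ i, |v i| ≤ 1 := fun i => (PiLp.norm_apply_le v i).trans hv
    have heq : x + ((1 / D ^ 2) • (A0 : Euc d →ₗ[ℝ] Euc d)) v =
        (1 - ∑ i, (1 / D + 1 / D ^ 2 * v i)) • a.1 + ∑ i, (1 / D + 1 / D ^ 2 * v i) • a.2 i := by
      simp only [LinearMap.smul_apply, LinearEquiv.coe_coe, hA0, x, Finset.smul_sum, smul_smul]
      rw [add_assoc, ← Finset.sum_add_distrib, sub_smul, one_smul, Finset.sum_smul, sub_add,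
        ← Finset.sum_sub_distrib, sub_eq_add_neg, ← Finset.sum_neg_distrib]
      congr 1
      refine Finset.sum_congr rfl fun i _ => ?_
      simp only [hb]
      module
    rw [heq]
    have hnn : ∀ i, 0 ≤ 1 / D + 1 / D ^ 2 * v i := by
      intro i
      have h1 := (abs_le.1 (hvi i)).1
      have h2 : 1 / D ^ 2 ≤ 1 / D := by
        apply one_div_le_one_div_of_le hDpos
        nlinarith
      have h3 : 0 < 1 / D ^ 2 := by positivity
      nlinarith
    have hsum : ∑ i, (1 / D + 1 / D ^ 2 * v i) ≤ 1 := by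
      calc ∑ i, (1 / D + 1 / D ^ 2 * v i) ≤ ∑ i : Fin d, (1 / D + 1 / D ^ 2) := by
            refine Finset.sum_le_sum fun i _ => ?_
            have h1 := (abs_le.1 (hvi i)).2
            have h3 : 0 < 1 / D ^ 2 := by positivity
            nlinarith
        _ = (D - 1) * (1 / D + 1 / D ^ 2) := by
            simp [hD]
            ring
        _ ≤ 1 := by
            have : (D - 1) * (1 / D + 1 / D ^ 2) = 1 - 1 / D ^ 2 := by
              field_simp
              ring
            rw [this]
            have h3 : 0 < 1 / D ^ 2 := by positivity
            linarith
    have hopt := hcv.sum_mem (t := (Finset.univ : Finset (Option (Fin d))))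
      (w := fun o => o.elim (1 - ∑ i, (1 / D + 1 / D ^ 2 * v i)) fun i => 1 / D + 1 / D ^ 2 * v i)
      (z := fun o => o.elim a.1 a.2) ?_ ?_ ?_
    · simpa [Fintype.sum_option] using hopt
    · rintro (_ | i) _
      · simpa using hsum
      · simpa using hnn i
    · rw [Fintype.sum_option]
      simp
    · rintro (_ | i) _
      · exact ha0
      · exact ha i
  · intro y hy
    let v : Euc d := WithLp.toLp 2 fun i => D ^ 2 * (bb.coord i (y - a.1) - 1 / D)
    have hv : ∀ i, v i = D ^ 2 * (bb.coord i (y - a.1) - 1 / D) := fun i => rfl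
    refine ⟨v, ?_, ?_⟩
    · have h1 : ∀ i, |v i| ≤ 2 * D ^ 2 := by
        intro i
        rw [hv, abs_mul, abs_of_pos (by positivity : (0 : ℝ) < D ^ 2)]
        have h2 : |bb.coord i (y - a.1) - 1 / D| ≤ 2 := by
          have h3 := abs_le.1 (hcoord y hy i)
          have h4 : 1 / D ≤ 1 := by rw [div_le_one hDpos]; exact hD1
          have h5 : 0 < 1 / D := by positivity
          rw [abs_le]
          constructor <;> linarith [h3.1, h3.2]
        nlinarith [sq_nonneg D]
      rw [EuclideanSpace.norm_eq]
      apply Real.sqrt_le_iff.2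
      refine ⟨by positivity, ?_⟩
      calc ∑ i, ‖v i‖ ^ 2 ≤ ∑ i : Fin d, (2 * D ^ 2) ^ 2 := by
            refine Finset.sum_le_sum fun i _ => ?_
            rw [Real.norm_eq_abs]
            exact pow_le_pow_left₀ (abs_nonneg _) (h1 i) 2
        _ = (D - 1) * (2 * D ^ 2) ^ 2 := by simp [hD]
        _ ≤ (2 * D ^ 3) ^ 2 := by
            have : (2 * D ^ 3) ^ 2 = D ^ 2 * (2 * D ^ 2) ^ 2 := by ring
            rw [this]
            apply mul_le_mul_of_nonneg_right _ (by positivity)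
            nlinarith
    · have h1 : y - a.1 = ∑ i, bb.coord i (y - a.1) • b i := by
        conv_lhs => rw [← bb.sum_repr (y - a.1)]
        refine Finset.sum_congr rfl fun i _ => ?_
        rw [hbb]
        rfl
      have h2 : y = a.1 + ∑ i, bb.coord i (y - a.1) • b i := by
        rw [← h1]; abel
      conv_lhs => rw [h2]
      simp only [LinearMap.smul_apply, LinearEquiv.coe_coe, hA0, x, Finset.smul_sum, smul_smul]
      rw [add_assoc, ← Finset.sum_add_distrib]
      congr 1
      refine Finset.sum_congr rfl fun i _ => ?_
      rw [← add_smul, hv]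
      congr 1
      field_simp
      ring

end PartJ

section PartC
variable {d : ℕ} {Ω : Set (Euc d)}

/-- The cap of `Ω` of width `w` in direction `u`. -/
def faCap (Ω : Set (Euc d)) (u : Euc d) (w : ℝ) : Set (Euc d) :=
  {y ∈ Ω | ∀ z ∈ Ω, ⟪u, z⟫ ≤ ⟪u, y⟫ + w}

/-- Support points. -/
def faSupp (Ω : Set (Euc d)) (u p : Euc d) : Prop := p ∈ Ω ∧ ∀ z ∈ Ω, ⟪u, z⟫ ≤ ⟪u, p⟫

lemma fa_supp (hcomp : IsCompact Ω) (hne : Ω.Nonempty) (u : Euc d) : ∃ p, faSupp Ω u p := by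
  obtain ⟨p, hp, hm⟩ := hcomp.exists_isMaxOn hne
    (f := fun y => ⟪u, y⟫) (by fun_prop)
  exact ⟨p, hp, fun z hz => hm hz⟩

lemma fa_cap_mono {u : Euc d} {w w' : ℝ} (h : w ≤ w') : faCap Ω u w ⊆ faCap Ω u w' :=
  fun _ hy => ⟨hy.1, fun z hz => (hy.2 z hz).trans (by linarith)⟩

lemma fa_supp_mem_cap {u p : Euc d} (hp : faSupp Ω u p) {w : ℝ} (hw : 0 ≤ w) :
    p ∈ faCap Ω u w :=
  ⟨hp.1, fun z hz => (hp.2 z hz).trans (by linarith)⟩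

lemma fa_mem_cap {u p : Euc d} (hp : faSupp Ω u p) {w : ℝ} {y : Euc d} (hy : y ∈ Ω)
    (h : ⟪u, p⟫ ≤ ⟪u, y⟫ + w) : y ∈ faCap Ω u w :=
  ⟨hy, fun z hz => (hp.2 z hz).trans h⟩

lemma fa_cap_convex (hcv : Convex ℝ Ω) (u : Euc d) (w : ℝ) : Convex ℝ (faCap Ω u w) := by
  intro x hx y hy a b ha hb hab
  refine ⟨hcv hx.1 hy.1 ha hb hab, fun z hz => ?_⟩
  rw [inner_add_right, real_inner_smul_right, real_inner_smul_right]
  have h1 := hx.2 z hz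
  have h2 := hy.2 z hz
  have hb' : b = 1 - a := by linarith
  subst hb'
  nlinarith

lemma fa_cap_compact (hcomp : IsCompact Ω) (u : Euc d) (w : ℝ) : IsCompact (faCap Ω u w) := by
  apply hcomp.of_isClosed_subset _ (fun _ hy => hy.1)
  have : faCap Ω u w = Ω ∩ ⋂ z ∈ Ω, {y | ⟪u, z⟫ ≤ ⟪u, y⟫ + w} := by
    ext y; simp [faCap]
  rw [this]
  refine hcomp.isClosed.inter (isClosed_biInter fun z _ => ?_)
  exact isClosed_le continuous_const (by fun_prop)

lemma fa_cap_scale (hcv : Convex ℝ Ω) {u p : Euc d} (hp : faSupp Ω u p) {s w : ℝ}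
    (hs : 1 ≤ s) {y : Euc d} (hy : y ∈ faCap Ω u (s * w)) :
    ∃ z ∈ faCap Ω u w, y = p + s • (z - p) := by
  have hs0 : 0 < s := by linarith
  refine ⟨p + s⁻¹ • (y - p), ?_, ?_⟩
  · apply fa_mem_cap hp
    · exact hcv.add_smul_sub_mem hp.1 hy.1 ⟨by positivity, inv_le_one_of_one_le₀ hs⟩
    · have h1 := hy.2 p hp.1
      rw [inner_add_right, real_inner_smul_right, inner_sub_right]
      have h2 : s⁻¹ * (⟪u, p⟫ - ⟪u, y⟫) ≤ s⁻¹ * (s * w) :=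
        mul_le_mul_of_nonneg_left (by linarith) (by positivity)
      rw [← mul_assoc, inv_mul_cancel₀ hs0.ne', one_mul] at h2
      linarith
  · rw [add_sub_cancel_left, smul_smul, mul_inv_cancel₀ hs0.ne', one_smul]
    abel

/-- If the base cap is inside an ellipsoid then the dilated cap is inside a dilated ellipsoid. -/
lemma fa_ell_scale (hcv : Convex ℝ Ω) {u p : Euc d} (hp : faSupp Ω u p) {s w k : ℝ}
    (hw : 0 ≤ w) (hs : 1 ≤ s) {x : Euc d} {A : Euc d →ₗ[ℝ] Euc d}
    (h : ∀ y ∈ faCap Ω u w, ∃ v, ‖v‖ ≤ k ∧ y = x + A v) :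
    ∀ y ∈ faCap Ω u (s * w), ∃ v, ‖v‖ ≤ 3 * s * k ∧ y = x + A v := by
  intro y hy
  obtain ⟨z, hz, rfl⟩ := fa_cap_scale hcv hp hs hy
  obtain ⟨v1, hv1, h1⟩ := h p (fa_supp_mem_cap hp hw)
  obtain ⟨v2, hv2, h2⟩ := h z hz
  refine ⟨v1 + s • (v2 - v1), ?_, ?_⟩
  · have hk : 0 ≤ k := (norm_nonneg _).trans hv1
    calc ‖v1 + s • (v2 - v1)‖ ≤ ‖v1‖ + ‖s • (v2 - v1)‖ := norm_add_le _ _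
      _ = ‖v1‖ + s * ‖v2 - v1‖ := by rw [norm_smul, Real.norm_of_nonneg (by linarith)]
      _ ≤ k + s * (k + k) := by
          gcongr
          exact (norm_sub_le _ _).trans (by linarith)
      _ ≤ 3 * s * k := by nlinarith
  · rw [map_add, map_smul, map_sub]
    have h3 : z - p = A v2 - A v1 := by rw [h1, h2]; abel
    rw [h3]
    conv_lhs => rw [h1]
    abel

lemma fa_primal {K : ℝ} (hK : 1 ≤ K) {u1 u2 x1 x2 : Euc d} {w1 w2 : ℝ}
    {A1 A2 : Euc d →ₗ[ℝ] Euc d} (h1 : IsChart (faCap Ω u1 w1) K x1 A1)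
    (h2 : IsChart (faCap Ω u2 w2) K x2 A2) {v1 v2 : Euc d} (hv1 : ‖v1‖ ≤ 1 / 2)
    (hv2 : ‖v2‖ ≤ 1 / 2) (heq : x1 + A1 v1 = x2 + A2 v2) :
    faCap Ω u2 w2 ⊆ faCap Ω u1 ((1 + 4 * K) * w1) := by
  intro y hy
  refine ⟨hy.1, fun q hq => ?_⟩
  obtain ⟨v, hv, rfl⟩ := h2.outer y hy
  have hz := h1.inner v1 (by linarith)
  have hK0 : 0 < K := by linarith
  have hm : x2 + A2 (v2 - (1 / (4 * K)) • (v - v2)) ∈ faCap Ω u2 w2 := by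
    apply h2.inner
    calc ‖v2 - (1 / (4 * K)) • (v - v2)‖ ≤ ‖v2‖ + ‖(1 / (4 * K)) • (v - v2)‖ := norm_sub_le _ _
      _ = ‖v2‖ + 1 / (4 * K) * ‖v - v2‖ := by
          rw [norm_smul, Real.norm_of_nonneg (by positivity)]
      _ ≤ 1 / 2 + 1 / (4 * K) * (2 * K) := by
          gcongr
          exact (norm_sub_le _ _).trans (by linarith)
      _ = 1 := by field_simp; norm_num
  have h3 := hz.2 _ hm.1
  have h4 := hz.2 q hq
  rw [heq] at h3 h4
  simp only [map_sub, map_smul, inner_add_right, inner_sub_right, real_inner_smul_right] at h3 h4 ⊢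
  have h5 : 1 / (4 * K) * (⟪u1, A2 v⟫ - ⟪u1, A2 v2⟫) ≥ - w1 := by linarith
  have h6 : ⟪u1, A2 v⟫ - ⟪u1, A2 v2⟫ ≥ - (4 * K * w1) := by
    have h7 := mul_le_mul_of_nonneg_left h5 (by positivity : 0 ≤ 4 * K)
    have h8 : 4 * K * (1 / (4 * K) * (⟪u1, A2 v⟫ - ⟪u1, A2 v2⟫)) = ⟪u1, A2 v⟫ - ⟪u1, A2 v2⟫ := by
      field_simp
    rw [h8] at h7
    linarith
  linarith

/-- The dual ellipsoid. -/
def faDual (u : Euc d) (A : Euc d →ₗ[ℝ] Euc d) (η : ℝ) : Set (Euc d) :=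
  {l | ‖LinearMap.adjoint A (l - u)‖ ≤ η}

lemma fa_dual_osc {K : ℝ} (hK : 1 ≤ K) {u x l : Euc d} {w : ℝ}
    {A : Euc d →ₗ[ℝ] Euc d} (h : IsChart (faCap Ω u w) K x A)
    (hl : l ∈ faDual u A (w / (4 * K))) {y y' : Euc d} (hy : y ∈ faCap Ω u w)
    (hy' : y' ∈ faCap Ω u w) : ⟪l, y - y'⟫ ≤ ⟪u, y - y'⟫ + w / 2 := by
  obtain ⟨v, hv, rfl⟩ := h.outer y hy
  obtain ⟨v', hv', rfl⟩ := h.outer y' hy'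
  have hK0 : 0 < K := by linarith
  have h1 : ⟪l - u, (x + A v) - (x + A v')⟫ ≤ w / 2 := by
    rw [add_sub_add_left_eq_sub, ← map_sub, ← LinearMap.adjoint_inner_left]
    have hl' : ‖LinearMap.adjoint A (l - u)‖ ≤ w / (4 * K) := hl
    calc ⟪LinearMap.adjoint A (l - u), v - v'⟫ ≤ ‖LinearMap.adjoint A (l - u)‖ * ‖v - v'‖ :=
          real_inner_le_norm _ _
      _ ≤ w / (4 * K) * (2 * K) := by
          gcongr
          · exact (norm_nonneg _).trans hl'
          · exact (norm_sub_le _ _).trans (by linarith)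
      _ = w / 2 := by field_simp; norm_num
  rw [inner_sub_left] at h1
  linarith

lemma fa_dual_drop {K : ℝ} (hK : 1 ≤ K) (hcv : Convex ℝ Ω) {u x l p : Euc d} {w : ℝ} (hw : 0 < w)
    {A : Euc d →ₗ[ℝ] Euc d} (h : IsChart (faCap Ω u w) K x A) (hp : faSupp Ω u p)
    (hl : l ∈ faDual u A (w / (4 * K))) {y : Euc d} (hy : y ∈ Ω) {s : ℝ} (hs : 1 ≤ s)
    (hys : ⟪u, p⟫ - ⟪u, y⟫ = s * w) : s * w / 2 ≤ ⟪l, p - y⟫ := by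
  obtain ⟨z, hz, rfl⟩ := fa_cap_scale hcv hp hs (show y ∈ faCap Ω u (s * w) from fa_mem_cap hp hy (by linarith))
  have hs0 : 0 < s := by linarith
  have h1 := fa_dual_osc hK h hl hz (fa_supp_mem_cap hp hw.le)
  have h2 : ⟪u, z - p⟫ = - w := by
    rw [inner_add_right, real_inner_smul_right] at hys
    have : s * (⟪u, z - p⟫ + w) = 0 := by linarith
    rcases mul_eq_zero.1 this with h | h <;> linarith
  have h3 : p - (p + s • (z - p)) = (-s) • (z - p) := by module
  rw [h3, real_inner_smul_right]
  nlinarith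

end PartC

section PartC2
variable {d : ℕ} {Ω : Set (Euc d)}

lemma fa_dual {K : ℝ} (hK : 1 ≤ K) (hcv : Convex ℝ Ω) (hcomp : IsCompact Ω) (hne : Ω.Nonempty)
    {u1 u2 x1 x2 l : Euc d} {w : ℝ} (hw : 0 < w)
    {A1 A2 : Euc d →ₗ[ℝ] Euc d} (h1 : IsChart (faCap Ω u1 w) K x1 A1)
    (h2 : IsChart (faCap Ω u2 w) K x2 A2)
    (hl1 : l ∈ faDual u1 A1 (w / (4 * K))) (hl2 : l ∈ faDual u2 A2 (w / (4 * K))) :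
    faCap Ω u2 w ⊆ faCap Ω u1 (3 * w) := by
  obtain ⟨p1, hp1⟩ := fa_supp hcomp hne u1
  obtain ⟨p2, hp2⟩ := fa_supp hcomp hne u2
  intro y hy
  have hmax : ∀ q ∈ Ω, ⟪l, q - y⟫ ≤ 3 / 2 * w := by
    have hcap : ∀ q ∈ faCap Ω u2 w, ⟪l, q - y⟫ ≤ 3 / 2 * w := by
      intro q hq
      have h3 := fa_dual_osc hK h2 hl2 hq hy
      have h4 := hy.2 q hq.1
      rw [inner_sub_right u2] at h3
      linarith
    intro q hq
    by_cases hqc : ⟪u2, p2⟫ - ⟪u2, q⟫ ≤ w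
    · exact hcap q (fa_mem_cap hp2 hq (by linarith))
    · push Not at hqc
      have h3 := fa_dual_drop hK hcv hw h2 hp2 hl2 hq (s := (⟪u2, p2⟫ - ⟪u2, q⟫) / w)
        (by rw [le_div_iff₀ hw]; linarith) (by field_simp)
      rw [div_mul_cancel₀ _ hw.ne'] at h3
      have h4 := hcap p2 (fa_supp_mem_cap hp2 hw.le)
      have h5 : ⟪l, q - y⟫ = ⟪l, p2 - y⟫ - ⟪l, p2 - q⟫ := by
        rw [← inner_sub_right]; congr 1; abel
      rw [h5]
      linarith
  apply fa_mem_cap hp1 hy.1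
  by_contra hcon
  push Not at hcon
  have h3 := fa_dual_drop hK hcv hw h1 hp1 hl1 hy.1 (s := (⟪u1, p1⟫ - ⟪u1, y⟫) / w)
        (by rw [le_div_iff₀ hw]; linarith) (by field_simp)
  rw [div_mul_cancel₀ _ hw.ne'] at h3
  have h4 := hmax p1 hp1.1
  linarith

lemma fa_ball_cap (hcv : Convex ℝ Ω) {o : Euc d} {r R : ℝ} (hR : 0 < R)
    (hin : closedBall o r ⊆ Ω) (hout : Ω ⊆ closedBall o R) {u p : Euc d} (hu : ‖u‖ = 1)
    (hp : faSupp Ω u p) {w : ℝ} (hw : 0 < w) (hwR : w ≤ 2 * R) :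
    ∃ y0, closedBall y0 (r * w / (2 * R)) ⊆ faCap Ω u w := by
  set t := w / (2 * R) with ht
  have ht0 : 0 < t := by positivity
  have ht1 : t ≤ 1 := by rw [ht, div_le_one (by positivity)]; exact hwR
  refine ⟨p + t • (o - p), fun z hz => ?_⟩
  have hz' : ‖z - (p + t • (o - p))‖ ≤ r * t := by
    rw [mem_closedBall, dist_eq_norm] at hz
    rw [ht, ← mul_div_assoc]; exact hz
  set q := p + t⁻¹ • (z - p) with hq
  have hzq : z = p + t • (q - p) := by
    rw [hq, add_sub_cancel_left, smul_smul, mul_inv_cancel₀ ht0.ne', one_smul]; abel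
  have hqΩ : q ∈ Ω := by
    apply hin
    rw [mem_closedBall, dist_eq_norm]
    have h1 : z - (p + t • (o - p)) = t • (q - o) := by
      conv_lhs => rw [hzq]
      module
    rw [h1, norm_smul, Real.norm_of_nonneg ht0.le] at hz'
    by_contra hcon
    push Not at hcon
    nlinarith
  rw [hzq]
  apply fa_mem_cap hp
  · exact hcv.add_smul_sub_mem hp.1 hqΩ ⟨ht0.le, ht1⟩
  · rw [inner_add_right, real_inner_smul_right]
    have h1 : -⟪u, q - p⟫ ≤ 2 * R := by
      rw [← inner_neg_right, neg_sub]
      calc ⟪u, p - q⟫ ≤ ‖u‖ * ‖p - q‖ := real_inner_le_norm _ _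
        _ = dist p q := by rw [hu, one_mul, dist_eq_norm]
        _ ≤ dist p o + dist q o := dist_triangle_right _ _ _
        _ ≤ 2 * R := by
          have := mem_closedBall.1 (hout hp.1)
          have := mem_closedBall.1 (hout hqΩ)
          linarith
    have h2 : t * (-⟪u, q - p⟫) ≤ t * (2 * R) := mul_le_mul_of_nonneg_left h1 ht0.le
    have h3 : t * (2 * R) = w := by rw [ht]; field_simp
    linarith

lemma fa_chart_ball {C : Set (Euc d)} {K : ℝ} (hK : 1 ≤ K) {x : Euc d} {A : Euc d →ₗ[ℝ] Euc d}
    (h : IsChart C K x A) {y0 : Euc d} {ρ : ℝ} (hb : closedBall y0 ρ ⊆ C) {e : Euc d}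
    (he : ‖e‖ ≤ ρ / K) : ∃ v, ‖v‖ ≤ 1 ∧ A v = e := by
  have hK0 : 0 < K := by linarith
  have hKe : ‖K • e‖ ≤ ρ := by
    rw [norm_smul, Real.norm_of_nonneg hK0.le]
    rw [le_div_iff₀ hK0] at he
    linarith
  obtain ⟨v1, hv1, h1⟩ := h.outer (y0 + K • e) (hb (by simpa [mem_closedBall, dist_eq_norm] using hKe))
  obtain ⟨v2, hv2, h2⟩ := h.outer (y0 - K • e) (hb (by
    rw [mem_closedBall, dist_eq_norm, sub_sub_cancel_left, norm_neg]; exact hKe))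
  refine ⟨(1 / (2 * K)) • (v1 - v2), ?_, ?_⟩
  · rw [norm_smul, Real.norm_of_nonneg (by positivity)]
    calc 1 / (2 * K) * ‖v1 - v2‖ ≤ 1 / (2 * K) * (2 * K) := by
          gcongr
          exact (norm_sub_le _ _).trans (by linarith)
      _ = 1 := by field_simp
  · rw [map_smul, map_sub]
    have : A v1 - A v2 = (2 * K) • e := by
      have h3 : A v1 - A v2 = (x + A v1) - (x + A v2) := by abel
      rw [h3, ← h1, ← h2]
      module
    rw [this, smul_smul]
    have : 1 / (2 * K) * (2 * K) = 1 := by field_simp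
    rw [this, one_smul]

/-- The half-size primal ellipsoid. -/
def faHalf (x : Euc d) (A : Euc d →ₗ[ℝ] Euc d) : Set (Euc d) :=
  (fun y => x + y) '' (A '' closedBall 0 (1 / 2))

lemma fa_vol_ell (x : Euc d) (A : Euc d →ₗ[ℝ] Euc d) {k : ℝ} (hk : 0 ≤ k) :
    volume.real ((fun y => x + y) '' (A '' closedBall (0 : Euc d) k)) =
      |LinearMap.det A| * (k ^ d * volume.real (closedBall (0 : Euc d) 1)) := by
  rw [measureReal_def, image_add_left, measure_preimage_add, Measure.addHaar_image_linearMap,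
    ENNReal.toReal_mul, ENNReal.toReal_ofReal (abs_nonneg _),
    Measure.addHaar_closedBall' _ _ hk, ENNReal.toReal_mul, ENNReal.toReal_ofReal (by positivity),
    finrank_euclideanSpace_fin]
  rfl

lemma fa_vol_dual (u : Euc d) (A : Euc d →ₗ[ℝ] Euc d) (hA : LinearMap.det A ≠ 0) {k : ℝ}
    (hk : 0 ≤ k) :
    volume.real (faDual u A k) =
      |LinearMap.det A|⁻¹ * (k ^ d * volume.real (closedBall (0 : Euc d) 1)) := by
  have hdet : LinearMap.det (LinearMap.adjoint A) = LinearMap.det A := by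
    let b := EuclideanSpace.basisFun (Fin d) ℝ
    rw [← LinearMap.det_toMatrix b.toBasis, ← LinearMap.det_toMatrix b.toBasis A,
      LinearMap.toMatrix_adjoint, Matrix.det_conjTranspose]
    simp
  have h1 : faDual u A k = (fun y => y + (-u)) ⁻¹' (LinearMap.adjoint A ⁻¹' closedBall 0 k) := by
    ext l
    simp [faDual, sub_eq_add_neg]
  rw [measureReal_def, h1, measure_preimage_add_right,
    Measure.addHaar_preimage_linearMap _ (by rw [hdet]; exact hA),
    ENNReal.toReal_mul, ENNReal.toReal_ofReal (abs_nonneg _),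
    Measure.addHaar_closedBall' _ _ hk, ENNReal.toReal_mul, ENNReal.toReal_ofReal (by positivity),
    finrank_euclideanSpace_fin, hdet, abs_inv]
  rfl

end PartC2

section PartC3
variable {d : ℕ} {Ω : Set (Euc d)}

lemma fa_half_compact (x : Euc d) (A : Euc d →ₗ[ℝ] Euc d) : IsCompact (faHalf x A) := by
  apply IsCompact.image _ (by fun_prop)
  exact (isCompact_closedBall _ _).image A.continuous_of_finiteDimensional

lemma fa_dual_closed (u : Euc d) (A : Euc d →ₗ[ℝ] Euc d) (k : ℝ) : IsClosed (faDual u A k) := by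
  apply isClosed_le _ continuous_const
  have := (LinearMap.adjoint A).continuous_of_finiteDimensional
  fun_prop

lemma fa_shell (hcv : Convex ℝ Ω) (hcomp : IsCompact Ω) {o : Euc d} {r : ℝ} (hr : 0 < r)
    (hin : closedBall o r ⊆ Ω) {w : ℝ} (hw : 0 < w) (hwr : w ≤ r / 2) :
    ∃ Sh : Set (Euc d), (∀ u : Euc d, ‖u‖ = 1 → faCap Ω u w ⊆ Sh) ∧ volume Sh ≠ ∞ ∧
      volume.real Sh ≤ d * (2 / r) * volume.real Ω * w := by
  set t := 2 * w / r with ht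
  have ht0 : 0 < t := by positivity
  have ht1 : t ≤ 1 := by rw [ht, div_le_one hr]; linarith
  have hoΩ : o ∈ Ω := hin (mem_closedBall_self hr.le)
  let H := AffineMap.homothety o (1 - t) '' Ω
  have hHΩ : H ⊆ Ω := by
    rintro _ ⟨z, hz, rfl⟩
    rw [AffineMap.homothety_apply]
    simp only [vsub_eq_sub, vadd_eq_add]
    rw [add_comm]
    exact hcv.add_smul_sub_mem hoΩ hz ⟨by linarith, by linarith⟩
  have hHcomp : IsCompact H := hcomp.image (AffineMap.homothety_continuous o (1 - t))
  have hfin : volume Ω ≠ ∞ := hcomp.measure_ne_top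
  refine ⟨Ω \ H, ?_, ?_, ?_⟩
  · intro u hu y hy
    refine ⟨hy.1, ?_⟩
    rintro ⟨z, hz, hzy⟩
    rw [AffineMap.homothety_apply] at hzy
    simp only [vsub_eq_sub, vadd_eq_add] at hzy
    have h1 : o + r • u ∈ Ω := by
      apply hin
      rw [mem_closedBall, dist_eq_norm, add_sub_cancel_left, norm_smul, hu,
        Real.norm_of_nonneg hr.le, mul_one]
    have h2 := hy.2 _ h1
    have h3 := hy.2 _ hz
    rw [← hzy] at h2 h3
    have huu : ⟪u, u⟫ = (1 : ℝ) := by rw [real_inner_self_eq_norm_sq, hu]; norm_num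
    simp only [inner_add_right, real_inner_smul_right, inner_sub_right, huu] at h2 h3
    have htr : t * r = 2 * w := by rw [ht]; field_simp
    nlinarith
  · exact measure_ne_top_of_subset sdiff_subset hfin
  · rw [measureReal_sdiff hHΩ hHcomp.measurableSet]
    have hH : volume.real H = (1 - t) ^ d * volume.real Ω := by
      rw [measureReal_def, Measure.addHaar_image_homothety, finrank_euclideanSpace_fin,
        ENNReal.toReal_mul, ENNReal.toReal_ofReal (abs_nonneg _),
        abs_of_nonneg (pow_nonneg (by linarith) _)]
      rfl
    have hb : 1 + (d : ℝ) * (-t) ≤ (1 + (-t)) ^ d := one_add_mul_le_pow (by linarith) d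
    have hv : 0 ≤ volume.real Ω := measureReal_nonneg
    rw [hH]
    have h1 : (1 - (1 - t) ^ d) * volume.real Ω ≤ (d * t) * volume.real Ω := by
      apply mul_le_mul_of_nonneg_right _ hv
      rw [← sub_eq_add_neg] at hb
      linarith
    have h2 : d * (2 / r) * volume.real Ω * w = (d * t) * volume.real Ω := by
      rw [ht]; ring
    rw [h2]
    linarith

lemma fa_dual_bdd {K : ℝ} (hK : 1 ≤ K) (hcv : Convex ℝ Ω) {o : Euc d} {r R : ℝ} (hr : 0 < r)
    (hR : 0 < R)
    (hin : closedBall o r ⊆ Ω) (hout : Ω ⊆ closedBall o R) {u p x : Euc d} (hu : ‖u‖ = 1)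
    (hp : faSupp Ω u p) {w : ℝ} (hw : 0 < w) (hwR : w ≤ 2 * R) {A : Euc d →ₗ[ℝ] Euc d}
    (h : IsChart (faCap Ω u w) K x A) :
    faDual u A (w / (4 * K)) ⊆ closedBall 0 (1 + R / (2 * r)) := by
  intro l hl
  obtain ⟨y0, hy0⟩ := fa_ball_cap hcv hR hin hout hu hp hw hwR
  have hK0 : 0 < K := by linarith
  set g := l - u with hg
  have hgn : ‖g‖ ≤ R / (2 * r) := by
    by_cases hg0 : g = 0
    · rw [hg0, norm_zero]; positivity
    · have hgpos : 0 < ‖g‖ := norm_pos_iff.2 hg0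
      set ρ := r * w / (2 * R) / K with hρ
      have hρ0 : 0 < ρ := by positivity
      obtain ⟨v, hv, hAv⟩ := fa_chart_ball hK h hy0 (e := (ρ / ‖g‖) • g) (by
        rw [norm_smul, Real.norm_of_nonneg (by positivity), div_mul_cancel₀ _ hgpos.ne'])
      have h1 : ⟪g, A v⟫ = ρ * ‖g‖ := by
        rw [hAv, real_inner_smul_right, real_inner_self_eq_norm_sq]
        field_simp
      have hl' : ‖LinearMap.adjoint A g‖ ≤ w / (4 * K) := hl
      rw [← LinearMap.adjoint_inner_left] at h1
      have h2 : ρ * ‖g‖ ≤ w / (4 * K) := by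
        rw [← h1]
        calc _ ≤ ‖LinearMap.adjoint A g‖ * ‖v‖ := real_inner_le_norm _ _
          _ ≤ w / (4 * K) * 1 := by
            gcongr
          _ = _ := mul_one _
      have h3 : R / (2 * r) = (w / (4 * K)) / ρ := by
        rw [hρ]; field_simp; norm_num
      rw [h3, le_div_iff₀ hρ0]
      linarith
  rw [mem_closedBall, dist_zero_right]
  have : l = u + g := by rw [hg]; abel
  rw [this]
  exact (norm_add_le _ _).trans (by rw [hu]; linarith)

lemma fa_count {K : ℝ} (hK : 1 ≤ K) (hcv : Convex ℝ Ω) (hcomp : IsCompact Ω) {o : Euc d}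
    {r R : ℝ} (hr : 0 < r) (hR : 0 < R) (hrR : r ≤ R)
    (hin : closedBall o r ⊆ Ω) (hout : Ω ⊆ closedBall o R) :
    ∃ M : ℝ, 0 ≤ M ∧ ∀ w : ℝ, 0 < w → w ≤ r / 2 → ∀ (x : Euc d → Euc d)
      (A : Euc d → (Euc d →ₗ[ℝ] Euc d)) (U : Finset (Euc d)),
      (∀ u ∈ U, ‖u‖ = 1 ∧ IsChart (faCap Ω u w) K (x u) (A u)) →
      ((U : Set (Euc d)).PairwiseDisjoint fun u => faHalf (x u) (A u)) →
      ((U : Set (Euc d)).PairwiseDisjoint fun u => faDual u (A u) (w / (4 * K))) →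
      (U.card : ℝ) ^ 2 * w ^ d ≤ M * w := by
  have hK0 : 0 < K := by linarith
  have hΩne : Ω.Nonempty := ⟨o, hin (mem_closedBall_self hr.le)⟩
  set β := volume.real (closedBall (0 : Euc d) 1) with hβ
  have hβ0 : 0 < β := by
    rw [hβ, measureReal_def]
    exact ENNReal.toReal_pos (measure_closedBall_pos volume _ one_pos).ne'
      (isCompact_closedBall _ _).measure_ne_top
  set X := d * (2 / r) * volume.real Ω with hX
  have hX0 : 0 ≤ X := by
    have : 0 ≤ volume.real Ω := measureReal_nonneg
    positivity
  set G := 1 + R / (2 * r) with hG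
  have hG0 : 0 < G := by positivity
  refine ⟨X * 2 ^ d / β * (G ^ d * (4 * K) ^ d), by positivity, ?_⟩
  intro w hw hwr x A U hU hd1 hd2
  have hdet : ∀ u ∈ U, 0 < |LinearMap.det (A u)| := fun u hu => abs_pos.2 (hU u hu).2.det_ne
  obtain ⟨Sh, hSh, hShfin, hShvol⟩ := fa_shell hcv hcomp hr hin hw hwr
  have hsum1 : ∑ u ∈ U, |LinearMap.det (A u)| * ((1 / 2) ^ d * β) ≤ X * w := by
    calc ∑ u ∈ U, |LinearMap.det (A u)| * ((1 / 2) ^ d * β)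
        = ∑ u ∈ U, volume.real (faHalf (x u) (A u)) := by
          refine Finset.sum_congr rfl fun u _ => ?_
          exact (fa_vol_ell (x u) (A u) (by norm_num)).symm
      _ = volume.real (⋃ u ∈ U, faHalf (x u) (A u)) := by
          refine (measureReal_biUnion_finset hd1 (fun u _ => (fa_half_compact _ _).measurableSet)
            (fun u _ => (fa_half_compact _ _).measure_ne_top)).symm
      _ ≤ volume.real Sh := by
          apply measureReal_mono _ hShfin
          refine iUnion₂_subset fun u hu => ?_
          rintro _ ⟨_, ⟨v, hv, rfl⟩, rfl⟩
          apply hSh u (hU u hu).1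
          apply (hU u hu).2.inner
          rw [mem_closedBall, dist_zero_right] at hv
          linarith
      _ ≤ X * w := hShvol
  have hsum2 : ∑ u ∈ U, |LinearMap.det (A u)|⁻¹ * ((w / (4 * K)) ^ d * β) ≤ G ^ d * β := by
    calc ∑ u ∈ U, |LinearMap.det (A u)|⁻¹ * ((w / (4 * K)) ^ d * β)
        = ∑ u ∈ U, volume.real (faDual u (A u) (w / (4 * K))) := by
          refine Finset.sum_congr rfl fun u hu => ?_
          exact (fa_vol_dual u (A u) (hU u hu).2.det_ne (by positivity)).symm
      _ = volume.real (⋃ u ∈ U, faDual u (A u) (w / (4 * K))) := by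
          refine (measureReal_biUnion_finset hd2 (fun u _ => (fa_dual_closed _ _ _).measurableSet)
            (fun u hu => ?_)).symm
          obtain ⟨p, hp⟩ := fa_supp hcomp hΩne u
          exact measure_ne_top_of_subset (fa_dual_bdd hK hcv hr hR hin hout (hU u hu).1 hp hw
            (by linarith) (hU u hu).2) (isCompact_closedBall _ _).measure_ne_top
      _ ≤ volume.real (closedBall (0 : Euc d) G) := by
          apply measureReal_mono _ (isCompact_closedBall _ _).measure_ne_top
          refine iUnion₂_subset fun u hu => ?_
          obtain ⟨p, hp⟩ := fa_supp hcomp hΩne u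
          exact fa_dual_bdd hK hcv hr hR hin hout (hU u hu).1 hp hw
            (by linarith) (hU u hu).2
      _ = G ^ d * β := by
          rw [measureReal_def, Measure.addHaar_closedBall' _ _ hG0.le, ENNReal.toReal_mul,
            ENNReal.toReal_ofReal (by positivity), finrank_euclideanSpace_fin]
          rfl
  rw [← Finset.sum_mul] at hsum1 hsum2
  have hs1 : ∑ u ∈ U, |LinearMap.det (A u)| ≤ X * 2 ^ d / β * w := by
    have : X * 2 ^ d / β * w = X * w / ((1 / 2) ^ d * β) := by
      rw [one_div, inv_pow]; field_simp
    rw [this, le_div_iff₀ (by positivity)]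
    exact hsum1
  have hs2 : (∑ u ∈ U, |LinearMap.det (A u)|⁻¹) * w ^ d ≤ G ^ d * (4 * K) ^ d := by
    have h1 : (∑ u ∈ U, |LinearMap.det (A u)|⁻¹) * (w / (4 * K)) ^ d ≤ G ^ d := by
      have := hsum2
      rw [← mul_assoc] at this
      exact le_of_mul_le_mul_right this hβ0
    rw [div_pow, ← mul_div_assoc, div_le_iff₀ (by positivity)] at h1
    exact h1
  have hcs : (U.card : ℝ) ^ 2 ≤ (∑ u ∈ U, |LinearMap.det (A u)|) *
      ∑ u ∈ U, |LinearMap.det (A u)|⁻¹ := by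
    have h1 := Finset.sum_mul_sq_le_sq_mul_sq U (fun u => √|LinearMap.det (A u)|)
      (fun u => (√|LinearMap.det (A u)|)⁻¹)
    have h2 : ∑ u ∈ U, √|LinearMap.det (A u)| * (√|LinearMap.det (A u)|)⁻¹ = U.card := by
      rw [Finset.card_eq_sum_ones]
      push_cast
      refine Finset.sum_congr rfl fun u hu => ?_
      exact mul_inv_cancel₀ (Real.sqrt_pos.2 (hdet u hu)).ne'
    rw [h2] at h1
    refine h1.trans (le_of_eq ?_)
    congr 1
    · refine Finset.sum_congr rfl fun u hu => ?_
      exact Real.sq_sqrt (abs_nonneg _)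
    · refine Finset.sum_congr rfl fun u hu => ?_
      rw [inv_pow, Real.sq_sqrt (abs_nonneg _)]
  have hnn : 0 ≤ ∑ u ∈ U, |LinearMap.det (A u)|⁻¹ :=
    Finset.sum_nonneg fun u _ => inv_nonneg.2 (abs_nonneg _)
  calc (U.card : ℝ) ^ 2 * w ^ d ≤ ((∑ u ∈ U, |LinearMap.det (A u)|) *
      ∑ u ∈ U, |LinearMap.det (A u)|⁻¹) * w ^ d := by gcongr
    _ = (∑ u ∈ U, |LinearMap.det (A u)|) * ((∑ u ∈ U, |LinearMap.det (A u)|⁻¹) * w ^ d) := by ring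
    _ ≤ (X * 2 ^ d / β * w) * (G ^ d * (4 * K) ^ d) := by gcongr
    _ = _ := by ring

end PartC3

section PartD
variable {d : ℕ} {Ω : Set (Euc d)}

lemma fa_det_compare {x x' : Euc d} {A A' : Euc d →ₗ[ℝ] Euc d} {k : ℝ} (hk : 0 ≤ k)
    (h : ∀ v, ‖v‖ ≤ 1 → ∃ v', ‖v'‖ ≤ k ∧ x + A v = x' + A' v') :
    |LinearMap.det A| ≤ k ^ d * |LinearMap.det A'| := by
  have hβ0 : 0 < volume.real (closedBall (0 : Euc d) 1) :=
    ENNReal.toReal_pos (measure_closedBall_pos _ _ one_pos).ne'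
      (isCompact_closedBall _ _).measure_ne_top
  have h1 : (fun y => x + y) '' (A '' closedBall (0 : Euc d) 1) ⊆
      (fun y => x' + y) '' (A' '' closedBall (0 : Euc d) k) := by
    rintro _ ⟨_, ⟨v, hv, rfl⟩, rfl⟩
    obtain ⟨v', hv', he⟩ := h v (by simpa using hv)
    exact ⟨A' v', ⟨v', by simpa using hv', rfl⟩, he.symm⟩
  have hc : IsCompact ((fun y => x' + y) '' (A' '' closedBall (0 : Euc d) k)) :=
    ((isCompact_closedBall _ _).image A'.continuous_of_finiteDimensional).image (by fun_prop)
  have h2 := measureReal_mono (μ := volume) h1 hc.measure_ne_top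
  rw [fa_vol_ell x A zero_le_one, fa_vol_ell x' A' hk, one_pow, one_mul, ← mul_assoc] at h2
  have := le_of_mul_le_mul_right h2 hβ0
  linarith

lemma fa_det_lower {A : Euc d →ₗ[ℝ] Euc d} {ρ : ℝ} (hρ : 0 ≤ ρ)
    (h : ∀ e : Euc d, ‖e‖ ≤ ρ → ∃ v, ‖v‖ ≤ 1 ∧ A v = e) : ρ ^ d ≤ |LinearMap.det A| := by
  have h1 := fa_det_compare (x := 0) (x' := 0) (A := ρ • (LinearMap.id : Euc d →ₗ[ℝ] Euc d))
    (A' := A) zero_le_one (fun v hv => by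
      obtain ⟨v', h1, h2⟩ := h (ρ • v) (by
        rw [norm_smul, Real.norm_of_nonneg hρ]; nlinarith)
      exact ⟨v', h1, by simp [h2]⟩)
  rw [LinearMap.det_smul, LinearMap.det_id, finrank_euclideanSpace_fin, mul_one, one_pow,
    one_mul, abs_of_nonneg (by positivity)] at h1
  exact h1

lemma fa_det_upper {o x : Euc d} {A : Euc d →ₗ[ℝ] Euc d} {R : ℝ} (hR : 0 ≤ R)
    (h : ∀ v, ‖v‖ ≤ 1 → x + A v ∈ closedBall o R) : |LinearMap.det A| ≤ R ^ d := by
  have h1 := fa_det_compare (x := x) (x' := o) (A := A)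
    (A' := (LinearMap.id : Euc d →ₗ[ℝ] Euc d)) hR (fun v hv => by
      refine ⟨x + A v - o, ?_, ?_⟩
      · have := h v hv
        rwa [mem_closedBall, dist_eq_norm] at this
      · simp)
  rwa [LinearMap.det_id, abs_one, mul_one] at h1

lemma fa_pack {x : Euc d → Euc d} {A : Euc d → Euc d →ₗ[ℝ] Euc d} {x' : Euc d}
    {A' : Euc d →ₗ[ℝ] Euc d} {k T : ℝ} (hk : 0 ≤ k) (S : Finset (Euc d))
    (hT : ∀ u ∈ S, T ≤ |LinearMap.det (A u)|)
    (hdis : (S : Set (Euc d)).PairwiseDisjoint (fun u => faHalf (x u) (A u)))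
    (h : ∀ u ∈ S, ∀ v, ‖v‖ ≤ 1 → ∃ v', ‖v'‖ ≤ k ∧ x u + A u v = x' + A' v') :
    (S.card : ℝ) * T ≤ (2 * k) ^ d * |LinearMap.det A'| := by
  set β := volume.real (closedBall (0 : Euc d) 1) with hβ
  have hβ0 : 0 < β :=
    ENNReal.toReal_pos (measure_closedBall_pos _ _ one_pos).ne'
      (isCompact_closedBall _ _).measure_ne_top
  have hc : IsCompact ((fun y => x' + y) '' (A' '' closedBall (0 : Euc d) k)) :=
    ((isCompact_closedBall _ _).image A'.continuous_of_finiteDimensional).image (by fun_prop)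
  have hs : (⋃ u ∈ S, faHalf (x u) (A u)) ⊆
      (fun y => x' + y) '' (A' '' closedBall (0 : Euc d) k) := by
    refine iUnion₂_subset fun u hu => ?_
    rintro _ ⟨_, ⟨v, hv, rfl⟩, rfl⟩
    have hv' : ‖v‖ ≤ 1 / 2 := by simpa using hv
    obtain ⟨v', hv', he⟩ := h u hu v (by linarith)
    exact ⟨A' v', ⟨v', by simpa using hv', rfl⟩, he.symm⟩
  have h2 := measureReal_mono (μ := volume) hs hc.measure_ne_top
  rw [measureReal_biUnion_finset hdis (fun u _ => (fa_half_compact _ _).measurableSet)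
    (fun u _ => (fa_half_compact _ _).measure_ne_top), fa_vol_ell x' A' hk] at h2
  have h3 : ∑ u ∈ S, T * ((1 / 2) ^ d * β) ≤ ∑ u ∈ S, volume.real (faHalf (x u) (A u)) := by
    refine Finset.sum_le_sum fun u hu => ?_
    rw [faHalf, fa_vol_ell (x u) (A u) (by norm_num)]
    exact mul_le_mul_of_nonneg_right (hT u hu) (by positivity)
  rw [Finset.sum_const, nsmul_eq_mul] at h3
  have h4 := h3.trans h2
  have h5 : (S.card : ℝ) * T * (1 / 2) ^ d ≤ k ^ d * |LinearMap.det A'| := by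
    apply le_of_mul_le_mul_right _ hβ0
    linarith
  rw [one_div, inv_pow, ← div_eq_mul_inv, div_le_iff₀ (by positivity)] at h5
  rw [mul_pow]
  linarith

lemma fa_hausdorff (hcv : Convex ℝ Ω) {V : Finset (Euc d)} (hV : V.Nonempty) (hVΩ : ∀ z ∈ V, z ∈ Ω)
    {η : ℝ} (hη : 0 ≤ η) (h : ∀ u : Euc d, ‖u‖ = 1 → ∃ z ∈ V, z ∈ faCap Ω u η) :
    Metric.hausdorffDist (convexHull ℝ (V : Set (Euc d))) Ω ≤ η := by
  have hP : convexHull ℝ (V : Set (Euc d)) ⊆ Ω := convexHull_min (fun z hz => hVΩ z hz) hcv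
  have hPc : IsCompact (convexHull ℝ (V : Set (Euc d))) := fa_isCompact_hull V
  have hPne : (convexHull ℝ (V : Set (Euc d))).Nonempty := by
    rw [convexHull_nonempty_iff]; exact hV
  apply Metric.hausdorffDist_le_of_mem_dist hη
  · intro y hy
    exact ⟨y, hP hy, by simpa using hη⟩
  · intro y hy
    obtain ⟨z, hz, hm⟩ := hPc.exists_isMinOn hPne (f := fun q => ‖y - q‖) (by fun_prop)
    refine ⟨z, hz, ?_⟩
    rw [dist_eq_norm]
    by_cases hyz : y - z = 0
    · simpa [hyz] using hη
    have hn : 0 < ‖y - z‖ := norm_pos_iff.2 hyz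
    have hobt : ∀ q ∈ convexHull ℝ (V : Set (Euc d)), ⟪y - z, q - z⟫ ≤ 0 := by
      rw [← norm_eq_iInf_iff_real_inner_le_zero (convex_convexHull ℝ _) hz]
      have : Nonempty (convexHull ℝ (V : Set (Euc d))) := hPne.to_subtype
      apply le_antisymm
      · exact le_ciInf fun q => hm q.2
      · exact ciInf_le ⟨0, by rintro _ ⟨q, rfl⟩; exact norm_nonneg _⟩
          (⟨z, hz⟩ : convexHull ℝ (V : Set (Euc d)))
    obtain ⟨q, hq, hc⟩ := h (‖y - z‖⁻¹ • (y - z)) (by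
      rw [norm_smul, norm_inv, norm_norm, inv_mul_cancel₀ hn.ne'])
    have h1 := hc.2 y hy
    have h2 := hobt q (subset_convexHull ℝ _ hq)
    rw [real_inner_smul_left, real_inner_smul_left] at h1
    have h3 : ⟪y - z, y⟫ - ⟪y - z, q⟫ ≥ ‖y - z‖ ^ 2 := by
      rw [← real_inner_self_eq_norm_sq (y - z)]
      have : ⟪y - z, y - z⟫ = ⟪y - z, y⟫ - ⟪y - z, z⟫ := inner_sub_right _ _ _
      rw [this]
      rw [inner_sub_right] at h2
      linarith
    have h4 : ‖y - z‖⁻¹ * (⟪y - z, y⟫ - ⟪y - z, q⟫) ≤ η := by linarith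
    have h5 : ‖y - z‖⁻¹ * ‖y - z‖ ^ 2 ≤ η :=
      (mul_le_mul_of_nonneg_left h3 (by positivity)).trans h4
    rw [pow_two, ← mul_assoc, inv_mul_cancel₀ hn.ne', one_mul] at h5
    exact h5

lemma fa_full_dim {o : Euc d} {r : ℝ} (hr : 0 < r) (hin : closedBall o r ⊆ Ω)
    {V : Finset (Euc d)} {η : ℝ} (hη : η < r)
    (h : ∀ u : Euc d, ‖u‖ = 1 → ∃ z ∈ V, z ∈ faCap Ω u η) :
    faceDim (convexHull ℝ (V : Set (Euc d))) = d := by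
  by_contra hne
  unfold faceDim at hne
  set D := (affineSpan ℝ (convexHull ℝ (V : Set (Euc d)))).direction with hD
  have hDt : D ≠ ⊤ := by
    intro ht
    rw [ht, finrank_top, finrank_euclideanSpace_fin] at hne
    exact hne rfl
  have hDo : Dᗮ ≠ ⊥ := fun hb => hDt (Submodule.orthogonal_eq_bot_iff.1 hb)
  obtain ⟨g, hg, hg0⟩ := Submodule.exists_mem_ne_zero_of_ne_bot hDo
  have hn : 0 < ‖g‖ := norm_pos_iff.2 hg0
  set u := ‖g‖⁻¹ • g with hu
  have hu1 : ‖u‖ = 1 := by rw [hu, norm_smul, norm_inv, norm_norm, inv_mul_cancel₀ hn.ne']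
  have huD : u ∈ Dᗮ := Dᗮ.smul_mem _ hg
  obtain ⟨z1, hz1, hc1⟩ := h u hu1
  obtain ⟨z2, hz2, hc2⟩ := h (-u) (by rwa [norm_neg])
  have hmem : z1 - z2 ∈ D := by
    rw [hD, ← vsub_eq_sub]
    exact AffineSubspace.vsub_mem_direction
      (subset_affineSpan ℝ _ (subset_convexHull ℝ _ hz1))
      (subset_affineSpan ℝ _ (subset_convexHull ℝ _ hz2))
  have h0 : ⟪u, z1 - z2⟫ = 0 := Submodule.inner_left_of_mem_orthogonal hmem huD
  have huu : ⟪u, u⟫ = (1 : ℝ) := by rw [real_inner_self_eq_norm_sq, hu1, one_pow]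
  have h1 := hc1.2 (o + r • u) (hin (by
    rw [mem_closedBall, dist_eq_norm, add_sub_cancel_left, norm_smul, hu1,
      Real.norm_of_nonneg hr.le, mul_one]))
  have h2 := hc2.2 (o - r • u) (hin (by
    rw [mem_closedBall, dist_eq_norm, sub_sub_cancel_left, norm_neg, norm_smul, hu1,
      Real.norm_of_nonneg hr.le, mul_one]))
  rw [inner_add_right, real_inner_smul_right, huu] at h1
  rw [inner_neg_left, inner_neg_left, inner_sub_right, real_inner_smul_right, huu] at h2
  rw [inner_sub_right] at h0
  linarith

/-- Existence of charts of caps. -/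
lemma fa_cap_chart (hcv : Convex ℝ Ω) (hcomp : IsCompact Ω) {o : Euc d} {r R : ℝ} (hr : 0 < r)
    (hR : 0 < R) (hin : closedBall o r ⊆ Ω) (hout : Ω ⊆ closedBall o R) {u : Euc d}
    (hu : ‖u‖ = 1) {w : ℝ} (hw : 0 < w) (hwR : w ≤ 2 * R) :
    ∃ x A, IsChart (faCap Ω u w) (2 * ((d : ℝ) + 1) ^ 3) x A := by
  have hne : Ω.Nonempty := ⟨o, hin (mem_closedBall_self hr.le)⟩
  obtain ⟨p, hp⟩ := fa_supp hcomp hne u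
  obtain ⟨y0, hy0⟩ := fa_ball_cap hcv hR hin hout hu hp hw hwR
  refine fa_john _ (fa_cap_compact hcomp u w) (fa_cap_convex hcv u w) ⟨y0, ?_⟩
  exact interior_mono hy0 (ball_subset_interior_closedBall (mem_ball_self (by positivity)))

/-- Maximal conflict-free families. -/
lemma fa_maximal (hcv : Convex ℝ Ω) (hcomp : IsCompact Ω) (hne : Ω.Nonempty) {K M : ℝ}
    (hK : 1 ≤ K) {w : ℝ} (hw : 0 < w) (x : Euc d → Euc d) (A : Euc d → Euc d →ₗ[ℝ] Euc d)
    (hch : ∀ u, ‖u‖ = 1 → IsChart (faCap Ω u w) K (x u) (A u)) (T : ℝ)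
    (hM : ∀ U : Finset (Euc d), (∀ u ∈ U, ‖u‖ = 1 ∧ IsChart (faCap Ω u w) K (x u) (A u)) →
      (U : Set (Euc d)).PairwiseDisjoint (fun u => faHalf (x u) (A u)) →
      (U : Set (Euc d)).PairwiseDisjoint (fun u => faDual u (A u) (w / (4 * K))) →
      (U.card : ℝ) ^ 2 * w ^ d ≤ M * w) :
    ∃ S : Finset (Euc d), (∀ u ∈ S, ‖u‖ = 1 ∧ T ≤ |LinearMap.det (A u)|) ∧
      (S : Set (Euc d)).PairwiseDisjoint (fun u => faHalf (x u) (A u)) ∧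
      (S.card : ℝ) ^ 2 * w ^ d ≤ M * w ∧
      ∀ u, ‖u‖ = 1 → T ≤ |LinearMap.det (A u)| → ∃ u' ∈ S,
        faCap Ω u' w ⊆ faCap Ω u ((1 + 4 * K) * w) ∧
        faCap Ω u w ⊆ faCap Ω u' ((1 + 4 * K) * w) := by
  let good : Finset (Euc d) → Prop := fun U =>
    (∀ u ∈ U, ‖u‖ = 1 ∧ T ≤ |LinearMap.det (A u)|) ∧
    (U : Set (Euc d)).PairwiseDisjoint (fun u => faHalf (x u) (A u)) ∧
    (U : Set (Euc d)).PairwiseDisjoint (fun u => faDual u (A u) (w / (4 * K)))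
  have hgood : ∀ U, good U → (U.card : ℝ) ^ 2 * w ^ d ≤ M * w := fun U hU =>
    hM U (fun u hu => ⟨(hU.1 u hu).1, hch u (hU.1 u hu).1⟩) hU.2.1 hU.2.2
  let Z : Set ℕ := {n | ∃ U, good U ∧ U.card = n}
  have hZne : Z.Nonempty := ⟨0, ∅, ⟨by simp, by simp, by simp⟩, rfl⟩
  have hZb : BddAbove Z := by
    refine ⟨⌈M * w / w ^ d⌉₊, ?_⟩
    rintro n ⟨U, hU, rfl⟩
    have h1 := hgood U hU
    rw [← le_div_iff₀ (by positivity)] at h1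
    have h2 : (U.card : ℝ) ≤ (U.card : ℝ) ^ 2 := by
      exact_mod_cast Nat.le_self_pow two_ne_zero _
    exact_mod_cast (h2.trans h1).trans (Nat.le_ceil _)
  obtain ⟨S, hS, hcard⟩ := Nat.sSup_mem hZne hZb
  refine ⟨S, hS.1, hS.2.1, hgood S hS, fun u hu hT => ?_⟩
  have hL : w ≤ (1 + 4 * K) * w := by nlinarith
  have h3 : 3 * w ≤ (1 + 4 * K) * w := by nlinarith
  by_cases huS : u ∈ S
  · exact ⟨u, huS, fa_cap_mono hL, fa_cap_mono hL⟩
  by_contra hcon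
  push Not at hcon
  have key : ∀ u' ∈ S, Disjoint (faHalf (x u) (A u)) (faHalf (x u') (A u')) ∧
      Disjoint (faDual u (A u) (w / (4 * K))) (faDual u' (A u') (w / (4 * K))) := by
    intro u' hu'
    have hu'1 := (hS.1 u' hu').1
    constructor
    · rw [Set.disjoint_left]
      rintro y ⟨_, ⟨v1, hv1, rfl⟩, h1⟩ ⟨_, ⟨v2, hv2, rfl⟩, h2⟩
      rw [mem_closedBall, dist_zero_right] at hv1 hv2
      have he : x u + A u v1 = x u' + A u' v2 := h1.trans h2.symm
      exact hcon u' hu' (fa_primal hK (hch u hu) (hch u' hu'1) hv1 hv2 he)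
        (fa_primal hK (hch u' hu'1) (hch u hu) hv2 hv1 he.symm)
    · rw [Set.disjoint_left]
      intro l hl1 hl2
      exact hcon u' hu'
        ((fa_dual hK hcv hcomp hne hw (hch u hu) (hch u' hu'1) hl1 hl2).trans (fa_cap_mono h3))
        ((fa_dual hK hcv hcomp hne hw (hch u' hu'1) (hch u hu) hl2 hl1).trans (fa_cap_mono h3))
  have hg : good (insert u S) := by
    refine ⟨?_, ?_, ?_⟩
    · intro v hv
      rcases Finset.mem_insert.1 hv with rfl | hv
      · exact ⟨hu, hT⟩
      · exact hS.1 v hv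
    · rw [Finset.coe_insert]
      exact hS.2.1.insert fun v hv _ => (key v hv).1
    · rw [Finset.coe_insert]
      exact hS.2.2.insert fun v hv _ => (key v hv).2
  have := le_csSup hZb (show (insert u S).card ∈ Z from ⟨_, hg, rfl⟩)
  rw [Finset.card_insert_of_notMem huS, ← hcard] at this
  omega

end PartD

section PartE
variable {d : ℕ} {Ω : Set (Euc d)}

lemma fa_main (hd : 1 ≤ d) (hcv : Convex ℝ Ω) (hcomp : IsCompact Ω) {o : Euc d} {r R : ℝ}
    (hr : 0 < r) (hR : 0 < R) (hrR : r ≤ R) (hin : closedBall o r ⊆ Ω)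
    (hout : Ω ⊆ closedBall o R) {K M : ℝ} (hK : 1 ≤ K) (hM0 : 0 ≤ M)
    (hM : ∀ w, 0 < w → w ≤ r / 2 → ∀ (x : Euc d → Euc d) (A : Euc d → Euc d →ₗ[ℝ] Euc d)
      (U : Finset (Euc d)), (∀ u ∈ U, ‖u‖ = 1 ∧ IsChart (faCap Ω u w) K (x u) (A u)) →
      (U : Set (Euc d)).PairwiseDisjoint (fun u => faHalf (x u) (A u)) →
      (U : Set (Euc d)).PairwiseDisjoint (fun u => faDual u (A u) (w / (4 * K))) →
      (U.card : ℝ) ^ 2 * w ^ d ≤ M * w)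
    (hchart : ∀ u : Euc d, ‖u‖ = 1 → ∀ w, 0 < w → w ≤ r / 2 →
      ∃ x A, IsChart (faCap Ω u w) K x A)
    {L Λ : ℝ} (hL : L = 1 + 4 * K) (hΛ : 2 * R * K * L / r < Λ) (m : ℕ) {ε τ : ℝ} (hε : 0 < ε)
    (hτ : 0 < τ) (hτ1 : τ ≤ 1) (hsm : L * (Λ ^ m * ε) ≤ r / 2)
    (hTm : τ ^ m ≤ (r * (Λ ^ m * ε) / (2 * R) / K) ^ d) :
    ∃ V : Finset (Euc d), V.Nonempty ∧ faceDim (convexHull ℝ (V : Set (Euc d))) = d ∧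
      Metric.hausdorffDist (convexHull ℝ (V : Set (Euc d))) Ω ≤ L * (Λ ^ m * ε) ∧
      ((flagSet d (convexHull ℝ (V : Set (Euc d)))).ncard : ℝ) ≤
        ((m + 1 : ℕ) * √(M / ε ^ (d - 1))) *
        ((m + 1 : ℕ) * ((2 * (3 * (2 * L) * (3 * L * K))) ^ d *
          (R ^ d + (3 * (L * Λ) * K) ^ d) / τ)) ^ d := by
  have hne : Ω.Nonempty := ⟨o, hin (mem_closedBall_self hr.le)⟩
  have hK0 : 0 < K := by linarith
  have hL1 : 1 ≤ L := by rw [hL]; linarith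
  have hL0 : 0 < L := by linarith
  have hΛ1 : 1 ≤ Λ := by
    refine le_trans ?_ hΛ.le
    rw [le_div_iff₀ hr, one_mul]
    have h1 : R ≤ R * K := by nlinarith
    have h2 : R * K ≤ R * K * L := le_mul_of_one_le_right (by positivity) hL1
    nlinarith [mul_pos (mul_pos hR hK0) hL0]
  have hΛ0 : 0 < Λ := by linarith
  set w : ℕ → ℝ := fun j => Λ ^ j * ε with hwdef
  have hw0 : ∀ j, 0 < w j := fun j => by positivity
  have hwm : ∀ i j, i ≤ j → w i ≤ w j := fun i j hij =>
    mul_le_mul_of_nonneg_right (pow_le_pow_right₀ hΛ1 hij) hε.le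
  have hwr : ∀ j, j ≤ m → w j ≤ r / 2 := fun j hj => (hwm j m hj).trans (by
    have : w m ≤ L * w m := le_mul_of_one_le_left (hw0 m).le hL1
    exact this.trans hsm)
  have hwR : ∀ j, j ≤ m → w j ≤ 2 * R := fun j hj => (hwr j hj).trans (by linarith)
  have h1 : ∀ j u, ∃ x A, j ≤ m → ‖u‖ = 1 → IsChart (faCap Ω u (w j)) K x A := by
    intro j u
    by_cases hj : j ≤ m ∧ ‖u‖ = 1
    · obtain ⟨x, A, h⟩ := hchart u hj.2 (w j) (hw0 j) (hwr j hj.1)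
      exact ⟨x, A, fun _ _ => h⟩
    · exact ⟨0, 0, fun h1 h2 => absurd ⟨h1, h2⟩ hj⟩
  choose x A hch using h1
  have h2 : ∀ j, ∃ S : Finset (Euc d), j ≤ m →
      ((∀ u ∈ S, ‖u‖ = 1 ∧ τ ^ j ≤ |LinearMap.det (A j u)|) ∧
      (S : Set (Euc d)).PairwiseDisjoint (fun u => faHalf (x j u) (A j u)) ∧
      (S.card : ℝ) ^ 2 * (w j) ^ d ≤ M * w j ∧
      ∀ u, ‖u‖ = 1 → τ ^ j ≤ |LinearMap.det (A j u)| → ∃ u' ∈ S,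
        faCap Ω u' (w j) ⊆ faCap Ω u (L * w j) ∧
        faCap Ω u (w j) ⊆ faCap Ω u' (L * w j)) := by
    intro j
    by_cases hj : j ≤ m
    · obtain ⟨S, hS⟩ := fa_maximal hcv hcomp hne hK (hw0 j) (x j) (A j)
        (fun u hu => hch j u hj hu) (τ ^ j) (hM (w j) (hw0 j) (hwr j hj) (x j) (A j))
      exact ⟨S, fun _ => by rw [hL]; exact hS⟩
    · exact ⟨∅, fun h => absurd h hj⟩
  choose S hS using h2
  -- balls inside the charts
  have hball : ∀ j u, j ≤ m → ‖u‖ = 1 → ∀ e : Euc d, ‖e‖ ≤ r * w j / (2 * R) / K →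
      ∃ v, ‖v‖ ≤ 1 ∧ A j u v = e := by
    intro j u hj hu e he
    obtain ⟨p, hp⟩ := fa_supp hcomp hne u
    obtain ⟨y0, hy0⟩ := fa_ball_cap hcv hR hin hout hu hp (hw0 j) (hwR j hj)
    exact fa_chart_ball hK (hch j u hj hu) hy0 he
  set Q := R ^ d + (3 * (L * Λ) * K) ^ d with hQ
  have hQ0 : 0 < Q := by positivity
  -- witnesses
  have hwit : ∀ u : Euc d, ‖u‖ = 1 → ∃ j, j ≤ m ∧ ∃ u' ∈ S j,
      faCap Ω u' (w j) ⊆ faCap Ω u (L * w j) ∧ faCap Ω u (w j) ⊆ faCap Ω u' (L * w j) ∧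
      |LinearMap.det (A j u')| ≤ Q * (τ ^ j / τ) := by
    intro u hu
    have hex : ∃ j, j ≤ m ∧ τ ^ j ≤ |LinearMap.det (A j u)| :=
      ⟨m, le_rfl, hTm.trans (fa_det_lower (by have := hw0 m; positivity)
        (hball m u le_rfl hu))⟩
    obtain ⟨hj, hjT⟩ := Nat.find_spec hex
    have hmin : ∀ i, i < Nat.find hex → ¬ (i ≤ m ∧ τ ^ i ≤ |LinearMap.det (A i u)|) :=
      fun i hi => Nat.find_min hex hi
    generalize Nat.find hex = j at hj hjT hmin
    obtain ⟨u', hu', hc1, hc2⟩ := (hS j hj).2.2.2 u hu hjT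
    refine ⟨j, hj, u', hu', hc1, hc2, ?_⟩
    have hu'1 := ((hS j hj).1 u' hu').1
    have hch' := hch j u' hj hu'1
    cases j with
    | zero =>
      have h3 : |LinearMap.det (A 0 u')| ≤ R ^ d :=
        fa_det_upper (o := o) (x := x 0 u') hR.le (fun v hv => hout (hch'.inner v hv).1)
      have h4 : (1 : ℝ) ≤ τ ^ 0 / τ := by rw [pow_zero, le_div_iff₀ hτ]; linarith
      have h5 : R ^ d ≤ Q := by
        rw [hQ]; exact le_add_of_nonneg_right (by positivity)
      exact h3.trans (h5.trans (le_mul_of_one_le_right hQ0.le h4))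
    | succ i =>
      have hi : i ≤ m := by omega
      have h3 : |LinearMap.det (A i u)| < τ ^ i := by
        have := hmin i (by omega)
        push Not at this
        exact this hi
      obtain ⟨p, hp⟩ := fa_supp hcomp hne u
      have hchi := hch i u hi hu
      have hsc := fa_ell_scale hcv hp (hw0 i).le (s := L * Λ)
        (by nlinarith) hchi.outer
      have hww : L * w (i + 1) = (L * Λ) * w i := by simp only [hwdef]; ring
      have h4 : |LinearMap.det (A (i + 1) u')| ≤
          (3 * (L * Λ) * K) ^ d * |LinearMap.det (A i u)| := by
        apply fa_det_compare (x := x (i + 1) u') (x' := x i u) (by positivity)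
        intro v hv
        have := hc1 (hch'.inner v hv)
        rw [hww] at this
        exact hsc _ this
      have h5 : τ ^ (i + 1) / τ = τ ^ i := by rw [pow_succ]; field_simp
      rw [h5]
      calc _ ≤ _ := h4
        _ ≤ (3 * (L * Λ) * K) ^ d * τ ^ i := by gcongr
        _ ≤ Q * τ ^ i := by
          gcongr
          rw [hQ]; exact le_add_of_nonneg_left (by positivity)
  set V : Finset (Euc d) := (Finset.range (m + 1)).biUnion fun j => (S j).image (x j) with hV
  have hmemV : ∀ z, z ∈ V ↔ ∃ j, j ≤ m ∧ ∃ u ∈ S j, x j u = z := by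
    intro z
    simp [hV, Nat.lt_succ_iff]
  have hxc : ∀ j u, j ≤ m → u ∈ S j → x j u ∈ faCap Ω u (w j) := by
    intro j u hj hu
    have := (hch j u hj ((hS j hj).1 u hu).1).inner 0 (by simp)
    simpa using this
  have hVΩ : ∀ z ∈ V, z ∈ Ω := by
    intro z hz
    obtain ⟨j, hj, u, hu, rfl⟩ := (hmemV z).1 hz
    exact (hxc j u hj hu).1
  have hdepth : ∀ u : Euc d, ‖u‖ = 1 → ∃ z ∈ V, z ∈ faCap Ω u (L * w m) := by
    intro u hu
    obtain ⟨j, hj, u', hu', hc1, -, -⟩ := hwit u hu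
    refine ⟨x j u', (hmemV _).2 ⟨j, hj, u', hu', rfl⟩, ?_⟩
    exact fa_cap_mono (mul_le_mul_of_nonneg_left (hwm j m hj) hL0.le) (hc1 (hxc j u' hj hu'))
  have hVne : V.Nonempty := by
    obtain ⟨z, hz, -⟩ := hdepth (EuclideanSpace.single ⟨0, hd⟩ 1) (by simp)
    exact ⟨z, hz⟩
  have hdim : faceDim (convexHull ℝ (V : Set (Euc d))) = d :=
    fa_full_dim hr hin (lt_of_le_of_lt hsm (by linarith)) hdepth
  refine ⟨V, hVne, hdim, fa_hausdorff hcv hVne hVΩ (mul_nonneg hL0.le (hw0 m).le) hdepth, ?_⟩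
  -- the collectors
  set C4 := 3 * (2 * L) * (3 * L * K) with hC4
  have hC40 : 0 < C4 := by positivity
  let inside : ℕ → Euc d → ℕ → Euc d → Prop := fun j u' i u'' =>
    ∀ v, ‖v‖ ≤ 1 → ∃ v', ‖v'‖ ≤ C4 ∧ x i u'' + A i u'' v = x j u' + A j u' v'
  let I : Finset (Σ _ : ℕ, Euc d) := ((Finset.range (m + 1)).sigma S).filter
    fun t => |LinearMap.det (A t.1 t.2)| ≤ Q * (τ ^ t.1 / τ)
  let B : (Σ _ : ℕ, Euc d) → Finset (Euc d) := fun t =>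
    (Finset.range (t.1 + 1)).biUnion fun i => ((S i).filter (inside t.1 t.2 i)).image (x i)
  set nr : ℝ := (m + 1 : ℕ) * ((2 * C4) ^ d * Q / τ) with hnr
  have hnr0 : 0 ≤ nr := by positivity
  have hBcard : ∀ t ∈ I, (B t).card ≤ ⌊nr⌋₊ := by
    rintro ⟨j, u'⟩ ht
    obtain ⟨ht1, ht2⟩ := Finset.mem_filter.1 ht
    obtain ⟨hj, hu'⟩ := Finset.mem_sigma.1 ht1
    simp only at ht2 hj hu'
    have hj : j ≤ m := Nat.lt_succ_iff.1 (Finset.mem_range.1 hj)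
    rw [Nat.le_floor_iff hnr0]
    have hT0 : 0 < τ ^ j := by positivity
    have hone : ∀ i ∈ Finset.range (j + 1),
        ((((S i).filter (inside j u' i)).image (x i)).card : ℝ) ≤ (2 * C4) ^ d * Q / τ := by
      intro i hi
      have hij : i ≤ j := Nat.lt_succ_iff.1 (Finset.mem_range.1 hi)
      have hp := fa_pack (x := x i) (A := A i) (x' := x j u') (A' := A j u') (T := τ ^ j) hC40.le
        ((S i).filter (inside j u' i))
        (fun u hu => (pow_le_pow_of_le_one hτ.le hτ1 hij).trans
          ((hS i (hij.trans hj)).1 u (Finset.mem_filter.1 hu).1).2)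
        ((hS i (hij.trans hj)).2.1.subset (by
          intro u hu
          exact (Finset.mem_filter.1 hu).1))
        (fun u hu => (Finset.mem_filter.1 hu).2)
      have h3 : ((((S i).filter (inside j u' i)).image (x i)).card : ℝ) ≤
          ((S i).filter (inside j u' i)).card := by exact_mod_cast Finset.card_image_le
      refine h3.trans (le_of_mul_le_mul_right ?_ hT0)
      calc _ ≤ _ := hp
        _ ≤ (2 * C4) ^ d * (Q * (τ ^ j / τ)) := by gcongr
        _ = _ := by ring
    calc ((B ⟨j, u'⟩).card : ℝ)
        ≤ ((∑ i ∈ Finset.range (j + 1),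
            (((S i).filter (inside j u' i)).image (x i)).card : ℕ) : ℝ) := by
          exact_mod_cast Finset.card_biUnion_le
      _ = ∑ i ∈ Finset.range (j + 1),
            ((((S i).filter (inside j u' i)).image (x i)).card : ℝ) := by push_cast; rfl
      _ ≤ ∑ i ∈ Finset.range (j + 1), (2 * C4) ^ d * Q / τ := Finset.sum_le_sum hone
      _ = (j + 1 : ℕ) * ((2 * C4) ^ d * Q / τ) := by
          rw [Finset.sum_const, Finset.card_range, nsmul_eq_mul]
      _ ≤ nr := by
          rw [hnr]
          have : ((j + 1 : ℕ) : ℝ) ≤ (m + 1 : ℕ) := by exact_mod_cast Nat.succ_le_succ hj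
          gcongr
  have hcover : ∀ u : Euc d, ‖u‖ = 1 → ∃ t ∈ I, ∀ z ∈ V,
      (∀ y ∈ V, ⟪u, y⟫ ≤ ⟪u, z⟫) → z ∈ B t := by
    intro u hu
    obtain ⟨j, hj, u', hu', hc1, hc2, hdet⟩ := hwit u hu
    have hu'1 := ((hS j hj).1 u' hu').1
    refine ⟨⟨j, u'⟩, Finset.mem_filter.2 ⟨Finset.mem_sigma.2
      ⟨Finset.mem_range.2 (Nat.lt_succ_iff.2 hj), hu'⟩, hdet⟩, ?_⟩
    intro z hz hmax
    have hz0 := hmax (x j u') ((hmemV _).2 ⟨j, hj, u', hu', rfl⟩)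
    have hzd : ∀ y ∈ Ω, ⟪u, y⟫ ≤ ⟪u, z⟫ + L * w j := fun y hy => by
      have := (hc1 (hxc j u' hj hu')).2 y hy
      linarith
    obtain ⟨i, hi, u'', hu'', rfl⟩ := (hmemV z).1 hz
    have hu''1 := ((hS i hi).1 u'' hu'').1
    have hch'' := hch i u'' hi hu''1
    have hij : i ≤ j := by
      by_contra hlt
      push Not at hlt
      have hρ : 0 ≤ r * w i / (2 * R) / K := by have := hw0 i; positivity
      obtain ⟨v, hv, he⟩ := hball i u'' hi hu''1 ((r * w i / (2 * R) / K) • u) (by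
        rw [norm_smul, hu, Real.norm_of_nonneg hρ, mul_one])
      have h3 := hzd _ (hch''.inner v hv).1
      rw [he, inner_add_right, real_inner_smul_right, real_inner_self_eq_norm_sq, hu] at h3
      have h4 : r * w i / (2 * R) / K ≤ L * w j := by linarith
      have h5 : Λ * w j ≤ w i := by
        refine le_trans (le_of_eq ?_) (hwm (j + 1) i hlt)
        simp only [hwdef]; ring
      rw [div_div, div_le_iff₀ (by positivity)] at h4
      rw [div_lt_iff₀ hr] at hΛ
      have h6 : r * (Λ * w j) ≤ r * w i := mul_le_mul_of_nonneg_left h5 hr.le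
      have h7 : 2 * R * K * L * w j < Λ * r * w j := mul_lt_mul_of_pos_right hΛ (hw0 j)
      nlinarith
    have hins : inside j u' i u'' := by
      intro v hv
      have hmem : x i u'' + A i u'' v ∈ faCap Ω u ((2 * L) * w j) := by
        refine ⟨(hch''.inner v hv).1, fun y hy => ?_⟩
        have h3 := hzd _ (hch''.inner (-v) (by rwa [norm_neg])).1
        have h4 := hzd y hy
        rw [map_neg, inner_add_right, inner_neg_right] at h3
        rw [inner_add_right]
        linarith
      obtain ⟨p, hp⟩ := fa_supp hcomp hne u
      obtain ⟨p', hp'⟩ := fa_supp hcomp hne u'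
      have hs1 := fa_ell_scale hcv hp' (hw0 j).le hL1 (hch j u' hj hu'1).outer
      have hs2 := fa_ell_scale hcv hp (hw0 j).le (s := 2 * L) (by linarith)
        (fun y hy => hs1 y (hc2 hy))
      exact hs2 _ hmem
    exact Finset.mem_biUnion.2 ⟨i, Finset.mem_range.2 (Nat.lt_succ_iff.2 hij),
      Finset.mem_image.2 ⟨u'', Finset.mem_filter.2 ⟨hu'', hins⟩, rfl⟩⟩
  have hflag := fa_flag_card hd V hdim I B ⌊nr⌋₊ hBcard hcover
  have hScard : ∀ j ∈ Finset.range (m + 1), ((S j).card : ℝ) ≤ √(M / ε ^ (d - 1)) := by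
    intro j hj
    have hj : j ≤ m := Nat.lt_succ_iff.1 (Finset.mem_range.1 hj)
    have h3 := (hS j hj).2.2.1
    apply Real.le_sqrt_of_sq_le
    rw [le_div_iff₀ (by positivity)]
    have h4 : w j ^ d = w j ^ (d - 1) * w j := by
      rw [← pow_succ, Nat.sub_add_cancel hd]
    rw [h4, ← mul_assoc] at h3
    have h5 := le_of_mul_le_mul_right h3 (hw0 j)
    refine le_trans ?_ h5
    have h6 : ε ≤ w j := by
      have := hwm 0 j (Nat.zero_le _)
      simpa [hwdef] using this
    gcongr
  have hIcard : (I.card : ℝ) ≤ (m + 1 : ℕ) * √(M / ε ^ (d - 1)) := by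
    calc (I.card : ℝ) ≤ (((Finset.range (m + 1)).sigma S).card : ℝ) := by
          exact_mod_cast Finset.card_filter_le _ _
      _ = ∑ j ∈ Finset.range (m + 1), ((S j).card : ℝ) := by
          rw [Finset.card_sigma]; push_cast; rfl
      _ ≤ ∑ j ∈ Finset.range (m + 1), √(M / ε ^ (d - 1)) := Finset.sum_le_sum hScard
      _ = _ := by rw [Finset.sum_const, Finset.card_range, nsmul_eq_mul]
  calc ((flagSet d (convexHull ℝ (V : Set (Euc d)))).ncard : ℝ)
      ≤ ((I.card * ⌊nr⌋₊ ^ d : ℕ) : ℝ) := by exact_mod_cast hflag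
    _ = (I.card : ℝ) * (⌊nr⌋₊ : ℝ) ^ d := by push_cast; rfl
    _ ≤ _ := by
      gcongr
      exact Nat.floor_le hnr0

end PartE

section PartF
variable {d : ℕ} {Ω : Set (Euc d)}

set_option maxHeartbeats 1000000 in
lemma fa_flagNumber_bound (hd : 1 ≤ d) (hcomp : IsCompact Ω) (hconv : Convex ℝ Ω)
    (hint : (interior Ω).Nonempty) {δ : ℝ} (hδ : 0 < δ) :
    ∃ C : ℝ, ∀ᶠ η in 𝓝[>] (0 : ℝ), Real.log (flagNumber d Ω η) ≤
      C + (((d : ℝ) - 1) / 2 + δ * d) * (- Real.log η) := by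
  obtain ⟨o, ho⟩ := hint
  obtain ⟨r0, hr0, hb⟩ := Metric.isOpen_iff.1 isOpen_interior o ho
  obtain ⟨R0, hR0⟩ := hcomp.isBounded.subset_closedBall o
  set r := r0 / 2 with hr_def
  set R := max R0 r with hR_def
  have hr : 0 < r := by positivity
  have hrR : r ≤ R := le_max_right _ _
  have hR : 0 < R := by linarith
  have hin : closedBall o r ⊆ Ω :=
    ((closedBall_subset_ball (by linarith)).trans hb).trans interior_subset
  have hout : Ω ⊆ closedBall o R := hR0.trans (closedBall_subset_closedBall (le_max_left _ _))
  set K : ℝ := 2 * ((d : ℝ) + 1) ^ 3 with hK_def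
  have hK : 1 ≤ K := by
    have : (1 : ℝ) ≤ ((d : ℝ) + 1) ^ 3 := one_le_pow₀ (by
      have : (0 : ℝ) ≤ d := Nat.cast_nonneg _
      linarith)
    rw [hK_def]; linarith
  have hK0 : 0 < K := by linarith
  obtain ⟨M, hM0, hM⟩ := fa_count hK hconv hcomp hr hR hrR hin hout
  have hchart : ∀ u : Euc d, ‖u‖ = 1 → ∀ w, 0 < w → w ≤ r / 2 →
      ∃ x A, IsChart (faCap Ω u w) K x A := fun u hu w hw hwr =>
    fa_cap_chart hconv hcomp hr hR hin hout hu hw (by linarith)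
  set L := 1 + 4 * K with hL
  have hL0 : 0 < L := by linarith
  set Λ := 2 * R * K * L / r + 1 with hΛ_def
  have hΛ : 2 * R * K * L / r < Λ := lt_add_one _
  have hΛ0 : 0 < Λ := by positivity
  obtain ⟨m, hm⟩ := exists_nat_ge (((d : ℝ) + 1) / δ)
  have hmδ : (d : ℝ) + 1 ≤ δ * m := by
    rw [div_le_iff₀ hδ] at hm; linarith
  set c := L * Λ ^ m with hc_def
  have hc : 0 < c := by positivity
  set c1 := (r * Λ ^ m / (2 * R) / K) ^ d with hc1_def
  have hc1 : 0 < c1 := by positivity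
  set C5 := (2 * (3 * (2 * L) * (3 * L * K))) ^ d * (R ^ d + (3 * (L * Λ) * K) ^ d) with hC5
  have hC50 : 0 < C5 := by positivity
  set G := ((m + 1 : ℕ) : ℝ) * √M * (((m + 1 : ℕ) : ℝ) * C5) ^ d with hG
  have hG0 : 0 ≤ G := by positivity
  set s := ((d : ℝ) - 1) / 2 + δ * d with hs
  have hd1 : (1 : ℝ) ≤ d := by exact_mod_cast hd
  have hs0 : 0 ≤ s := by rw [hs]; have : 0 ≤ δ * d := by positivity
                         linarith
  refine ⟨Real.log (G + 1) + s * Real.log c, ?_⟩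
  have hev : ∀ᶠ η in 𝓝[>] (0 : ℝ), η < min (r / 2) (min c (c1 * c)) :=
    (eventually_lt_nhds (by positivity : (0 : ℝ) < min (r / 2) (min c (c1 * c)))).filter_mono
      nhdsWithin_le_nhds
  filter_upwards [hev, self_mem_nhdsWithin] with η hη hη0
  have hη0 : 0 < η := hη0
  have hη1 : η < r / 2 := hη.trans_le (min_le_left _ _)
  have hη2 : η < c := hη.trans_le ((min_le_right _ _).trans (min_le_left _ _))
  have hη3 : η < c1 * c := hη.trans_le ((min_le_right _ _).trans (min_le_right _ _))
  set ε := η / c with hε_def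
  have hε : 0 < ε := by positivity
  have hε1 : ε ≤ 1 := by rw [hε_def, div_le_one hc]; exact hη2.le
  have hε2 : ε ≤ c1 := by rw [hε_def, div_le_iff₀ hc]; exact hη3.le
  have hηε : L * (Λ ^ m * ε) = η := by
    rw [← mul_assoc, ← hc_def, hε_def, mul_div_cancel₀ _ hc.ne']
  set τ := ε ^ δ with hτ_def
  have hτ : 0 < τ := Real.rpow_pos_of_pos hε _
  have hτ1 : τ ≤ 1 := Real.rpow_le_one hε.le hε1 hδ.le
  have hTm : τ ^ m ≤ (r * (Λ ^ m * ε) / (2 * R) / K) ^ d := by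
    have h1 : (r * (Λ ^ m * ε) / (2 * R) / K) ^ d = c1 * ε ^ d := by
      rw [hc1_def, ← mul_pow]; congr 1; ring
    rw [h1, hτ_def, ← Real.rpow_mul_natCast hε.le]
    calc ε ^ (δ * m) ≤ ε ^ ((d : ℝ) + 1) := Real.rpow_le_rpow_of_exponent_ge hε hε1 hmδ
      _ = ε * ε ^ d := by
        rw [Real.rpow_add hε, Real.rpow_one, Real.rpow_natCast, mul_comm]
      _ ≤ _ := by gcongr
  obtain ⟨V, hVne, hdim, hhd, hfl⟩ := fa_main hd hconv hcomp hr hR hrR hin hout hK hM0 hM hchart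
    hL hΛ m hε hτ hτ1 (by rw [hηε]; exact hη1.le) hTm
  rw [hηε] at hhd
  have hN : flagNumber d Ω η ≤ (flagSet d (convexHull ℝ (V : Set (Euc d)))).ncard :=
    Nat.sInf_le ⟨V, hVne, hdim, hhd, rfl⟩
  have hN' : (flagNumber d Ω η : ℝ) ≤ (G + 1) * ε ^ (-s) := by
    refine (Nat.cast_le.2 hN).trans (hfl.trans ?_)
    have h1 : √(M / ε ^ (d - 1)) = √M * ε ^ (-(((d : ℝ) - 1) / 2)) := by
      rw [Real.sqrt_div' _ (by positivity), Real.rpow_neg hε.le, div_eq_mul_inv]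
      congr 2
      rw [Real.sqrt_eq_rpow, ← Real.rpow_natCast_mul hε.le, Nat.cast_sub hd]
      congr 1
      push_cast; ring
    have h2 : (1 / τ) ^ d = ε ^ (-(δ * d)) := by
      rw [Real.rpow_neg hε.le, Real.rpow_mul_natCast hε.le, one_div, inv_pow]
    have h3 : ε ^ (-s) = ε ^ (-(((d : ℝ) - 1) / 2)) * ε ^ (-(δ * d)) := by
      rw [← Real.rpow_add hε]; congr 1; rw [hs]; ring
    rw [h1, ← hC5]
    have h4 : ((m + 1 : ℕ) : ℝ) * (√M * ε ^ (-(((d : ℝ) - 1) / 2))) *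
        (((m + 1 : ℕ) : ℝ) * (C5 / τ)) ^ d = G * ε ^ (-s) := by
      rw [h3, ← h2, hG, div_eq_mul_one_div C5 τ, ← mul_assoc _ C5, mul_pow _ (1 / τ)]
      ring
    rw [h4]
    have : 0 < ε ^ (-s) := Real.rpow_pos_of_pos hε _
    nlinarith
  have hlogε : Real.log ε = Real.log η - Real.log c := Real.log_div hη0.ne' hc.ne'
  have hε_log : Real.log ε ≤ 0 := Real.log_nonpos hε.le hε1
  have hfin : Real.log (flagNumber d Ω η) ≤ Real.log (G + 1) + s * (- Real.log ε) := by
    rcases Nat.eq_zero_or_pos (flagNumber d Ω η) with h0 | hpos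
    · rw [h0, Nat.cast_zero, Real.log_zero]
      have : 0 ≤ Real.log (G + 1) := Real.log_nonneg (by linarith)
      have : 0 ≤ s * (- Real.log ε) := mul_nonneg hs0 (by linarith)
      linarith
    · have h1 := Real.log_le_log (by exact_mod_cast hpos) hN'
      rw [Real.log_mul (by positivity) (Real.rpow_pos_of_pos hε _).ne', Real.log_rpow hε] at h1
      linarith
  rw [hlogε] at hfin
  linarith

lemma fa_final (hd : 1 ≤ d) (hcomp : IsCompact Ω) (hconv : Convex ℝ Ω)
    (hint : (interior Ω).Nonempty) : flagApprox d Ω ≤ ((d : ℝ) - 1) / 2 := by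
  have hd1 : (1 : ℝ) ≤ d := by exact_mod_cast hd
  rw [flagApprox, Filter.liminf_eq]
  refine Real.sSup_le (fun a ha => ?_) (by linarith)
  have ha : ∀ᶠ η in 𝓝[>] (0 : ℝ), a ≤ Real.log (flagNumber d Ω η) / (- Real.log η) := ha
  refine le_of_forall_pos_le_add fun t ht => ?_
  obtain ⟨C, hC⟩ := fa_flagNumber_bound hd hcomp hconv hint (δ := t / d) (by positivity)
  have htd : t / d * d = t := div_mul_cancel₀ _ (by positivity)
  rw [htd] at hC
  have hlog : Tendsto (fun η : ℝ => - Real.log η) (𝓝[>] 0) atTop :=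
    tendsto_neg_atBot_atTop.comp Real.tendsto_log_nhdsGT_zero
  have hlim : Tendsto (fun η : ℝ => C / (- Real.log η) + (((d : ℝ) - 1) / 2 + t)) (𝓝[>] 0)
      (𝓝 (0 + (((d : ℝ) - 1) / 2 + t))) :=
    (hlog.const_div_atTop C).add tendsto_const_nhds
  rw [zero_add] at hlim
  refine ge_of_tendsto hlim ?_
  filter_upwards [ha, hC, hlog.eventually_gt_atTop 0] with η h1 h2 h3
  refine h1.trans ?_
  rw [div_le_iff₀ h3, add_mul, div_mul_cancel₀ _ h3.ne']
  exact h2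

end PartF

/-- For a convex body `Ω ⊆ ℝ^d` (`d ≥ 1`), the flag approximability
satisfies `a_f(Ω) ≤ (d - 1)/2`. -/
theorem flagApprox_le (d : ℕ) (hd : 1 ≤ d) (Ω : Set (Euc d))
    (hcomp : IsCompact Ω) (hconv : Convex ℝ Ω) (hint : (interior Ω).Nonempty) :
    flagApprox d Ω ≤ ((d : ℝ) - 1) / 2 := by
  exact fa_final hd hcomp hconv hint

end
end

section
/- Let d ≥ 1 and let Ω ⊆ ℝ^d be a convex body. Then for every base point p ∈ int Ω, the volume entropy satisfies liminf_{R→∞} (1/R)·log Vol^B_{int Ω}(B_{int Ω}(p,R)) ≤ d − 1. -/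
open Filter Set MeasureTheory Metric
open scoped ENNReal Topology Pointwise RealInnerProductSpace

noncomputable section
open scoped Classical

/-! ### Volumes of boxes and slabs -/

lemma vol_box {d : ℕ} (a b : Fin d → ℝ) :
    volume {x : Euc d | ∀ i, x i ∈ Icc (a i) (b i)} = ∏ i, ENNReal.ofReal (b i - a i) := by
  have h := (PiLp.volume_preserving_ofLp (Fin d)).measure_preimage
    (s := Set.pi univ fun i => Icc (a i) (b i))
    (MeasurableSet.univ_pi fun i => measurableSet_Icc).nullMeasurableSet
  rw [volume_pi_pi] at h
  simp only [Real.volume_Icc] at h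
  rw [← h]
  congr 1
  ext x
  simp [Pi.le_def, forall_and]

lemma vol_slab {e : ℕ} (n : Euc (e+1)) (hn : ‖n‖ = 1) (a b : ℝ) :
    volume {u : Euc (e+1) | ‖u‖ ≤ a ∧ 0 ≤ ⟪n, u⟫ ∧ ⟪n, u⟫ ≤ b} ≤
      ENNReal.ofReal b * ENNReal.ofReal (2 * a) ^ e := by
  have hv : Orthonormal ℝ (({0} : Set (Fin (e+1))).domRestrict (fun _ : Fin (e+1) => n)) := by
    rw [orthonormal_iff_ite]
    rintro ⟨i, hi⟩ ⟨j, hj⟩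
    simp only [mem_singleton_iff] at hi hj
    subst hi; subst hj
    simp [Set.domRestrict, hn]
  obtain ⟨B, hB⟩ := hv.exists_orthonormalBasis_extension_of_card_eq (by simp)
  have hB0 : B 0 = n := hB 0 (by simp)
  let lo : Fin (e+1) → ℝ := Fin.cons 0 (fun _ => -a)
  let hi : Fin (e+1) → ℝ := Fin.cons b (fun _ => a)
  have hsub : {u : Euc (e+1) | ‖u‖ ≤ a ∧ 0 ≤ ⟪n, u⟫ ∧ ⟪n, u⟫ ≤ b} ⊆
      B.repr ⁻¹' {x : Euc (e+1) | ∀ i, x i ∈ Icc (lo i) (hi i)} := by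
    rintro u ⟨h1, h2, h3⟩ i
    refine Fin.cases ?_ (fun j => ?_) i
    · simp only [lo, hi, Fin.cons_zero, B.repr_apply_apply, hB0]
      exact ⟨h2, h3⟩
    · simp only [lo, hi, Fin.cons_succ, B.repr_apply_apply]
      have : |⟪B j.succ, u⟫| ≤ a := by
        have := abs_real_inner_le_norm (B j.succ) u
        simp only [B.orthonormal.1, one_mul] at this
        linarith
      exact abs_le.1 this
  refine (measure_mono hsub).trans ?_
  have hm : MeasurableSet {x : Euc (e+1) | ∀ i, x i ∈ Icc (lo i) (hi i)} := by
    have : {x : Euc (e+1) | ∀ i, x i ∈ Icc (lo i) (hi i)} =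
      ⋂ i, (fun x : Euc (e+1) => x i) ⁻¹' Icc (lo i) (hi i) := by ext; simp
    rw [this]
    exact MeasurableSet.iInter fun i => (by fun_prop : Measurable fun x : Euc (e+1) => x i) measurableSet_Icc
  rw [B.measurePreserving_repr.measure_preimage hm.nullMeasurableSet, vol_box, Fin.prod_univ_succ]
  simp only [lo, hi, Fin.cons_zero, Fin.cons_succ, Finset.prod_const, Finset.card_univ,
    Fintype.card_fin]
  apply le_of_eq
  congr 3 <;> ring

/-! ### The key slice estimate -/

lemma slice_est {e : ℕ} (K : Set (Euc (e+1))) (hK : IsCompact K) (hc : Convex ℝ K)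
    (τ : ℝ) (hτ : 8 ≤ τ) (z : Euc (e+1)) :
    volume {x : Euc (e+1) | x ∈ K ∧ τ^2/4 ≤ ‖τ^2 • (z - x)‖ ∧
      ∀ k ∈ K, ⟪τ^2 • (z - x), k - x⟫ ≤ 1} ≤
      ENNReal.ofReal (8 / τ^2) * ENNReal.ofReal (2 * (1/τ)) ^ e := by
  rcases K.eq_empty_or_nonempty with h0 | hne
  · simp [h0]
  obtain ⟨y, hyK, hy⟩ := exists_norm_eq_iInf_of_complete_convex hne hK.isComplete hc z
  rw [norm_eq_iInf_iff_real_inner_le_zero hc hyK] at hy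
  have hτ0 : 0 < τ := by linarith
  have hT : 0 < τ^2 := by positivity
  have key : ∀ x ∈ K, τ^2/4 ≤ ‖τ^2 • (z - x)‖ → (∀ k ∈ K, ⟪τ^2 • (z - x), k - x⟫ ≤ 1) →
      ‖y - x‖ ≤ 1/τ ∧ 1/8 ≤ ‖z - y‖ ∧ 0 ≤ ⟪z - y, y - x⟫ ∧ ⟪z - y, y - x⟫ ≤ 1/τ^2 := by
    intro x hx h1 h2
    have h3 := h2 y hyK
    rw [real_inner_smul_left] at h3
    have h3' : ⟪z - x, y - x⟫ ≤ 1/τ^2 := by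
      rw [le_div_iff₀ hT]; linarith
    have h4 := hy x hx
    have h4' : ⟪z - y, y - x⟫ = - ⟪z - y, x - y⟫ := by
      rw [← inner_neg_right]; simp
    have h5 : ⟪z - x, y - x⟫ = ⟪z - y, y - x⟫ + ‖y - x‖^2 := by
      rw [← real_inner_self_eq_norm_sq, ← inner_add_left]; simp
    have h6 : ‖y - x‖ ≤ 1/τ := by
      apply le_of_sq_le_sq _ (by positivity)
      rw [div_pow, one_pow]; linarith
    refine ⟨h6, ?_, by linarith, by nlinarith [sq_nonneg ‖y - x‖]⟩
    rw [norm_smul, Real.norm_of_nonneg hT.le] at h1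
    have h7 : 1/4 ≤ ‖z - x‖ := by nlinarith
    have h8 : ‖z - x‖ ≤ ‖z - y‖ + ‖y - x‖ := by
      simpa using norm_add_le (z - y) (y - x)
    have h9 : 1/τ ≤ 1/8 := one_div_le_one_div_of_le (by norm_num) hτ
    linarith
  by_cases hzy : 1/8 ≤ ‖z - y‖
  swap
  · have : {x : Euc (e+1) | x ∈ K ∧ τ^2/4 ≤ ‖τ^2 • (z - x)‖ ∧
      ∀ k ∈ K, ⟪τ^2 • (z - x), k - x⟫ ≤ 1} = ∅ := by
      rw [Set.eq_empty_iff_forall_notMem]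
      rintro x ⟨hx, h1, h2⟩
      exact hzy (key x hx h1 h2).2.1
    rw [this]; simp
  set n : Euc (e+1) := ‖z - y‖⁻¹ • (z - y) with hn
  have hpos : 0 < ‖z - y‖ := by linarith
  have hn1 : ‖n‖ = 1 := by
    rw [hn, norm_smul, norm_inv, norm_norm, inv_mul_cancel₀ hpos.ne']
  refine le_trans ?_ (vol_slab n hn1 (1/τ) (8/τ^2))
  have hcl : IsClosed {u : Euc (e+1) | ‖u‖ ≤ 1/τ ∧ 0 ≤ ⟪n, u⟫ ∧ ⟪n, u⟫ ≤ 8/τ^2} := by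
    simp only [Set.ofPred_and]
    refine IsClosed.inter ?_ (IsClosed.inter ?_ ?_) <;>
      exact isClosed_le (by fun_prop) (by fun_prop)
  rw [← (Measure.measurePreserving_sub_left volume y).measure_preimage hcl.measurableSet.nullMeasurableSet]
  apply measure_mono
  rintro x ⟨hx, h1, h2⟩
  obtain ⟨a1, a2, a3, a4⟩ := key x hx h1 h2
  refine ⟨a1, ?_, ?_⟩
  · rw [hn, real_inner_smul_left]; positivity
  · rw [hn, real_inner_smul_left, inv_mul_le_iff₀ hpos]
    calc _ ≤ 1/τ^2 := a4
      _ = 1/8 * (8/τ^2) := by ring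
      _ ≤ _ := by gcongr

/-! ### The phase-space body and its shells -/

/-- Pairs `(x, w)` with `x ∈ K`, `w` in the polar of `K - x`, and `‖w‖ ≤ T`. -/
def phaseBody {d : ℕ} (K : Set (Euc d)) (T : ℝ) : Set (Euc d × Euc d) :=
  {q | q.1 ∈ K ∧ ‖q.2‖ ≤ T ∧ ∀ k ∈ K, ⟪q.2, k - q.1⟫ ≤ (1 : ℝ)}

/-- The part of `phaseBody K T` with `T / 4 ≤ ‖w‖`. -/
def phaseShell {d : ℕ} (K : Set (Euc d)) (T : ℝ) : Set (Euc d × Euc d) :=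
  {q | q.1 ∈ K ∧ T / 4 ≤ ‖q.2‖ ∧ ‖q.2‖ ≤ T ∧ ∀ k ∈ K, ⟪q.2, k - q.1⟫ ≤ (1 : ℝ)}

lemma isClosed_polarCond {d : ℕ} (K : Set (Euc d)) :
    IsClosed {q : Euc d × Euc d | ∀ k ∈ K, ⟪q.2, k - q.1⟫ ≤ (1 : ℝ)} := by
  have : {q : Euc d × Euc d | ∀ k ∈ K, ⟪q.2, k - q.1⟫ ≤ (1 : ℝ)} =
    ⋂ k ∈ K, {q : Euc d × Euc d | ⟪q.2, k - q.1⟫ ≤ (1 : ℝ)} := by ext; simp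
  rw [this]
  exact isClosed_biInter fun k _ => isClosed_le (by fun_prop) (by fun_prop)

lemma isClosed_phaseBody {d : ℕ} {K : Set (Euc d)} (hK : IsClosed K) (T : ℝ) :
    IsClosed (phaseBody K T) := by
  unfold phaseBody
  simp only [Set.ofPred_and]
  exact (hK.preimage continuous_fst).inter
    ((isClosed_le (by fun_prop) (by fun_prop)).inter (isClosed_polarCond K))

lemma isClosed_phaseShell {d : ℕ} {K : Set (Euc d)} (hK : IsClosed K) (T : ℝ) :
    IsClosed (phaseShell K T) := by
  unfold phaseShell
  simp only [Set.ofPred_and]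
  exact (hK.preimage continuous_fst).inter ((isClosed_le (by fun_prop) (by fun_prop)).inter
    ((isClosed_le (by fun_prop) (by fun_prop)).inter (isClosed_polarCond K)))

lemma phaseShell_vol {e : ℕ} (K : Set (Euc (e+1))) (hK : IsCompact K) (hc : Convex ℝ K)
    (ρ : ℝ) (hρ : ∀ x ∈ K, ‖x‖ ≤ ρ) (τ : ℝ) (hτ : 8 ≤ τ) :
    volume (phaseShell K (τ^2)) ≤
      (ENNReal.ofReal (8 * 2 ^ e) * volume (closedBall (0 : Euc (e+1)) (ρ+1))) *
        ENNReal.ofReal (τ ^ e) := by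
  have hτ0 : 0 < τ := by linarith
  have hT : 0 < τ^2 := by positivity
  have hcl := isClosed_phaseShell hK.isClosed (τ^2)
  set E := phaseShell K (τ^2) with hE
  set Φ : Euc (e+1) × Euc (e+1) → Euc (e+1) × Euc (e+1) := fun q => (q.1, τ^2 • (q.2 - q.1)) with hΦ
  have hΦc : Continuous Φ := by fun_prop
  have hE' : MeasurableSet (Φ ⁻¹' E) := (hcl.preimage hΦc).measurableSet
  have h1 : volume E = ENNReal.ofReal ((τ^2)^(e+1)) * volume (Φ ⁻¹' E) := by
    rw [Measure.volume_eq_prod, Measure.prod_apply hcl.measurableSet, Measure.prod_apply hE',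
      ← lintegral_const_mul _ (measurable_measure_prodMk_left hE')]
    refine lintegral_congr fun x => ?_
    have : Prod.mk x ⁻¹' (Φ ⁻¹' E) =
        (fun z => z + (-x)) ⁻¹' ((fun z => τ^2 • z) ⁻¹' (Prod.mk x ⁻¹' E)) := by
      ext z; simp [hΦ, sub_eq_add_neg]
    rw [this, measure_preimage_add_right, Measure.addHaar_preimage_smul _ hT.ne', ← mul_assoc,
      ← ENNReal.ofReal_mul (by positivity)]
    have : (τ^2)^(e+1) * |((τ^2) ^ Module.finrank ℝ (Euc (e+1)))⁻¹| = 1 := by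
      rw [finrank_euclideanSpace_fin, abs_of_pos (by positivity), mul_inv_cancel₀ (by positivity)]
    rw [this]; simp
  have h2 : volume (Φ ⁻¹' E) ≤ (ENNReal.ofReal (8 / τ^2) * ENNReal.ofReal (2 * (1/τ)) ^ e) *
      volume (closedBall (0 : Euc (e+1)) (ρ+1)) := by
    rw [Measure.volume_eq_prod, Measure.prod_apply_symm hE',
      ← setLIntegral_const, ← lintegral_indicator measurableSet_closedBall]
    refine lintegral_mono fun z => ?_
    by_cases hz : z ∈ closedBall (0 : Euc (e+1)) (ρ+1)
    · rw [indicator_of_mem hz]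
      refine le_trans (measure_mono ?_) (slice_est K hK hc τ hτ z)
      rintro x ⟨a1, a2, a3, a4⟩
      exact ⟨a1, a2, a4⟩
    · rw [indicator_of_notMem hz]
      have : (fun x => (x, z)) ⁻¹' (Φ ⁻¹' E) = ∅ := by
        rw [Set.eq_empty_iff_forall_notMem]
        rintro x ⟨a1, a2, a3, a4⟩
        apply hz
        simp only [hΦ, norm_smul, Real.norm_of_nonneg hT.le] at a1 a3
        have : ‖z - x‖ ≤ 1 := by nlinarith
        have h3 : ‖z‖ ≤ ‖z - x‖ + ‖x‖ := by simpa using norm_add_le (z - x) x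
        have := hρ x a1
        simp only [mem_closedBall, dist_zero_right]
        linarith
      rw [this]; simp
  rw [h1]
  refine (mul_le_mul_right h2 _).trans (le_of_eq ?_)
  rw [← ENNReal.ofReal_pow (by positivity), ← mul_assoc, ← mul_assoc,
    ← ENNReal.ofReal_mul (by positivity), ← ENNReal.ofReal_mul (by positivity),
    mul_right_comm (ENNReal.ofReal (8 * 2 ^ e)),
    ← ENNReal.ofReal_mul (by positivity)]
  have hq : (2 * (1/τ))^e = 2^e / τ^e := by rw [mul_one_div, div_pow]
  rw [hq]
  congr 2
  field_simp
  ring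

lemma phaseBody_finite {d : ℕ} (K : Set (Euc d)) (hK : IsCompact K) (T : ℝ) :
    volume (phaseBody K T) < ∞ := by
  refine lt_of_le_of_lt (measure_mono (t := K ×ˢ closedBall (0 : Euc d) T) ?_)
    (hK.prod (isCompact_closedBall 0 T)).measure_lt_top
  rintro ⟨x, w⟩ ⟨h1, h2, -⟩
  exact ⟨h1, by simpa using h2⟩

lemma phaseBody_vol {e : ℕ} (K : Set (Euc (e+1))) (hK : IsCompact K) (hc : Convex ℝ K) :
    ∃ C : ℝ, 1 ≤ C ∧ ∀ N : ℕ, 3 ≤ N →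
      volume (phaseBody K (4^N)) ≤ ENNReal.ofReal (C * (N+1) * (2^N)^e) := by
  obtain ⟨ρ, hρ⟩ := hK.isBounded.exists_norm_le
  set C0 : ℝ := (volume (phaseBody K (4^3))).toReal
  set C1 : ℝ := (ENNReal.ofReal (8 * 2 ^ e) * volume (closedBall (0 : Euc (e+1)) (ρ+1))).toReal
  have hC0 : volume (phaseBody K (4^3)) = ENNReal.ofReal C0 :=
    (ENNReal.ofReal_toReal (phaseBody_finite K hK _).ne).symm
  have hC1 : ENNReal.ofReal (8 * 2 ^ e) * volume (closedBall (0 : Euc (e+1)) (ρ+1)) =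
      ENNReal.ofReal C1 :=
    (ENNReal.ofReal_toReal (ENNReal.mul_lt_top ENNReal.ofReal_lt_top
      measure_closedBall_lt_top).ne).symm
  have p0 : 0 ≤ C0 := ENNReal.toReal_nonneg
  have p1 : 0 ≤ C1 := ENNReal.toReal_nonneg
  refine ⟨C0 + C1 + 1, by linarith, fun N hN => ?_⟩
  induction N, hN using Nat.le_induction with
  | base =>
    rw [hC0]
    apply ENNReal.ofReal_le_ofReal
    have : (1 : ℝ) ≤ (2^3)^e := one_le_pow₀ (by norm_num)
    push_cast
    nlinarith
  | succ N hN ih =>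
    have hsub : phaseBody K (4^(N+1)) ⊆ phaseBody K (4^N) ∪ phaseShell K ((2^(N+1))^2) := by
      rintro ⟨x, w⟩ ⟨h1, h2, h3⟩
      have e4 : ((2:ℝ)^(N+1))^2 = 4^(N+1) := by rw [← pow_mul, mul_comm, pow_mul]; norm_num
      rcases le_total ‖w‖ (4^N) with h | h
      · exact Or.inl ⟨h1, h, h3⟩
      · refine Or.inr ⟨h1, ?_, ?_, h3⟩
        · rw [e4, pow_succ]; simpa using h
        · rw [e4]; exact h2
    have h8 : (8:ℝ) ≤ 2^(N+1) := by
      calc (8:ℝ) = 2^3 := by norm_num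
        _ ≤ 2^(N+1) := pow_le_pow_right₀ (by norm_num) (by omega)
    refine (measure_mono hsub).trans ((measure_union_le _ _).trans ?_)
    refine (add_le_add ih (phaseShell_vol K hK hc ρ hρ _ h8)).trans ?_
    rw [hC1, ← ENNReal.ofReal_mul p1, ← ENNReal.ofReal_add (by positivity) (by positivity)]
    apply ENNReal.ofReal_le_ofReal
    have hm : ((2:ℝ)^N)^e ≤ (2^(N+1))^e := by
      gcongr
      · norm_num
      · omega
    have hp : (0:ℝ) ≤ (2^(N+1))^e := by positivity
    push_cast
    calc (C0 + C1 + 1) * (N+1) * (2^N)^e + C1 * (2^(N+1))^e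
        ≤ (C0 + C1 + 1) * (N+1) * (2^(N+1))^e + (C0 + C1 + 1) * (2^(N+1))^e := by
          gcongr; linarith
      _ = _ := by ring

/-! ### The volume product estimate -/

/-- The polar of `K - x`. -/
def polarAt {d : ℕ} (K : Set (Euc d)) (x : Euc d) : Set (Euc d) :=
  {w | ∀ k ∈ K, ⟪w, k - x⟫ ≤ (1 : ℝ)}

lemma convex_polarAt {d : ℕ} (K : Set (Euc d)) (x : Euc d) : Convex ℝ (polarAt K x) := by
  intro u hu v hv a b ha hb hab k hk
  have h1 := hu k hk
  have h2 := hv k hk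
  rw [inner_add_left, real_inner_smul_left, real_inner_smul_left]
  nlinarith

lemma zero_mem_polarAt {d : ℕ} (K : Set (Euc d)) (x : Euc d) : (0 : Euc d) ∈ polarAt K x := by
  intro k _; simp

lemma isClosed_polarAt {d : ℕ} (K : Set (Euc d)) (x : Euc d) : IsClosed (polarAt K x) := by
  have : polarAt K x = ⋂ k ∈ K, {w : Euc d | ⟪w, k - x⟫ ≤ (1 : ℝ)} := by ext; simp [polarAt]
  rw [this]
  exact isClosed_biInter fun k _ => isClosed_le (by fun_prop) (by fun_prop)

lemma polarAt_norm_le {d : ℕ} {K : Set (Euc d)} {x : Euc d} {δ : ℝ} (hδ : 0 < δ)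
    (hb : closedBall x δ ⊆ K) {w : Euc d} (hw : w ∈ polarAt K x) : ‖w‖ ≤ 1 / δ := by
  rcases eq_or_ne w 0 with rfl | h0
  · simp; positivity
  have hpos : 0 < ‖w‖ := norm_pos_iff.2 h0
  have h := hw (x + (δ * ‖w‖⁻¹) • w) (hb (by
    simp [norm_smul, abs_of_pos hδ, inv_mul_cancel₀ hpos.ne', mul_assoc]))
  rw [add_sub_cancel_left, real_inner_smul_right, real_inner_self_eq_norm_sq] at h
  rw [le_div_iff₀ hδ]
  have : δ * ‖w‖⁻¹ * ‖w‖^2 = ‖w‖ * δ := by field_simp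
  linarith

lemma det_lp {d : ℕ} (A : Matrix (Fin d) (Fin d) ℝ) :
    LinearMap.det (Matrix.toEuclideanLin A) = A.det := by
  rw [Matrix.toEuclideanLin_eq_toLin_orthonormal, LinearMap.det_toLin]

/-- For a compact convex `L ∋ 0` spanning the space, the volume of `L` times the volume of its
symmetric polar is bounded below. -/
lemma exists_auerbach {d : ℕ} (hd : 1 ≤ d) (L : Set (Euc d)) (hL : IsCompact L) (hc : Convex ℝ L)
    (h0 : (0 : Euc d) ∈ L) (δ : ℝ) (hδ : 0 < δ) (hb : closedBall (0 : Euc d) δ ⊆ L) :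
    ENNReal.ofReal ((1 / (d:ℝ))^d * (1/(d:ℝ))^d) ≤
      volume {v : Euc d | ∀ w ∈ L, |⟪v, w⟫| ≤ 1/2} * volume L := by
  have hd0 : (0:ℝ) < d := by exact_mod_cast hd
  let D : (Fin d → Euc d) → ℝ := fun l => |(Matrix.of fun i j => l i j).det|
  have hD : Continuous D := by
    refine Continuous.abs (Continuous.matrix_det ?_)
    refine continuous_matrix fun i j => ?_
    simp only [Matrix.of_apply]
    fun_prop
  obtain ⟨l, hl, hmax⟩ := (isCompact_univ_pi (fun _ : Fin d => hL)).exists_isMaxOn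
    ⟨fun _ => 0, fun _ _ => h0⟩ hD.continuousOn
  have hlL : ∀ i, l i ∈ L := fun i => hl i (mem_univ i)
  have hmax' : ∀ l' : Fin d → Euc d, (∀ i, l' i ∈ L) → D l' ≤ D l := fun l' h =>
    hmax (fun i _ => h i)
  set A : Matrix (Fin d) (Fin d) ℝ := Matrix.of fun i j => l i j with hA
  have hDl : D l = |A.det| := rfl
  have hApos : 0 < |A.det| := by
    rw [← hDl]
    refine lt_of_lt_of_le ?_ (hmax' (fun i => EuclideanSpace.single i δ) fun i => hb (by
      simp [abs_of_pos hδ]))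
    have : (Matrix.of fun i j => (EuclideanSpace.single i δ : Euc d) j) =
        Matrix.diagonal (fun _ : Fin d => δ) := by
      ext i j
      simp [Matrix.diagonal_apply, eq_comm]
    simp only [D, this, Matrix.det_diagonal]
    simp only [Finset.prod_const]
    positivity
  have hAne : A.det ≠ 0 := abs_pos.1 hApos
  -- first volume
  have hV1 : ENNReal.ofReal (|A.det|⁻¹ * (1/(d:ℝ))^d) ≤
      volume {v : Euc d | ∀ w ∈ L, |⟪v, w⟫| ≤ 1/2} := by
    have hbox := vol_box (d := d) (fun _ => -(1/(2*(d:ℝ)))) (fun _ => 1/(2*(d:ℝ)))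
    have hpre := Measure.addHaar_preimage_linearMap (volume : Measure (Euc d))
      (f := Matrix.toEuclideanLin A) (by rw [det_lp]; exact hAne)
      {x : Euc d | ∀ i, x i ∈ Icc (-(1/(2*(d:ℝ)))) (1/(2*(d:ℝ)))}
    rw [hbox, det_lp, Finset.prod_const, ← ENNReal.ofReal_pow (by
      rw [sub_neg_eq_add]; positivity), ← ENNReal.ofReal_mul (by positivity)] at hpre
    have e1 : |A.det⁻¹| * (1 / (2 * (d:ℝ)) - -(1 / (2 * (d:ℝ)))) ^ (Finset.univ : Finset (Fin d)).card
        = |A.det|⁻¹ * (1/(d:ℝ))^d := by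
      rw [abs_inv, Finset.card_univ, Fintype.card_fin]
      congr 2
      field_simp
      norm_num
    rw [e1] at hpre
    rw [← hpre]
    apply measure_mono
    intro v hv w hw
    have hv' : ∀ i, |⟪v, l i⟫| ≤ 1/(2*(d:ℝ)) := by
      intro i
      have := hv i
      rw [abs_le]
      have e2 : (Matrix.toEuclideanLin A v) i = ⟪v, l i⟫ := by
        simp [Matrix.toLpLin_apply, Matrix.mulVec, dotProduct, hA, PiLp.inner_apply]
      rw [e2] at this
      exact this
    -- coordinates of `w`
    let a : Fin d → ℝ := fun i => (A.updateRow i w).det / A.det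
    have ha : ∀ i, |a i| ≤ 1 := by
      intro i
      rw [abs_div, div_le_one hApos, ← hDl]
      have := hmax' (Function.update l i w) (by
        intro j
        rcases eq_or_ne j i with rfl | h
        · simpa using hw
        · simpa [h] using hlL j)
      have e5 : A.updateRow i w = Matrix.of fun i' j => (Function.update l i w i') j := by
        ext j k
        rcases eq_or_ne j i with rfl | h
        · simp
        · simp [h, hA]
      rw [e5]
      exact this
    have hwa : w = ∑ i, a i • l i := by
      have h := Matrix.mulVec_cramer A.transpose (w : Fin d → ℝ)
      ext j
      have hj := congrFun h j
      simp only [Matrix.mulVec, dotProduct, Matrix.transpose_apply, Matrix.cramer_transpose_apply,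
        Matrix.det_transpose, Pi.smul_apply, smul_eq_mul] at hj
      simp only [WithLp.ofLp_sum, WithLp.ofLp_smul, Finset.sum_apply, Pi.smul_apply, smul_eq_mul, a]
      rw [← mul_right_inj' hAne, ← hj, Finset.mul_sum]
      refine Finset.sum_congr rfl fun i _ => ?_
      have e6 : A i j = (l i) j := rfl
      rw [e6]
      field_simp
    rw [hwa, inner_sum]
    calc |∑ i, ⟪v, a i • l i⟫| ≤ ∑ i, |⟪v, a i • l i⟫| := Finset.abs_sum_le_sum_abs _ _
      _ ≤ ∑ i : Fin d, 1/(2*(d:ℝ)) := by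
        refine Finset.sum_le_sum fun i _ => ?_
        rw [real_inner_smul_right, abs_mul]
        calc |a i| * |⟪v, l i⟫| ≤ 1 * (1/(2*(d:ℝ))) :=
              mul_le_mul (ha i) (hv' i) (abs_nonneg _) zero_le_one
          _ = _ := one_mul _
      _ = 1/2 := by simp; field_simp
  have hV2 : ENNReal.ofReal (|A.det| * (1/(d:ℝ))^d) ≤ volume L := by
    have hbox := vol_box (d := d) (fun _ => 0) (fun _ => 1/(d:ℝ))
    have him := Measure.addHaar_image_linearMap (volume : Measure (Euc d))
      (Matrix.toEuclideanLin A.transpose) {x : Euc d | ∀ i, x i ∈ Icc 0 (1/(d:ℝ))}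
    rw [hbox, det_lp, Matrix.det_transpose, Finset.prod_const, ← ENNReal.ofReal_pow (by
      rw [sub_zero]; positivity), ← ENNReal.ofReal_mul (by positivity), sub_zero,
      Finset.card_univ, Fintype.card_fin] at him
    rw [← him]
    apply measure_mono
    rintro _ ⟨c, hcc, rfl⟩
    have e3 : Matrix.toEuclideanLin A.transpose c = ∑ i, c i • l i := by
      ext j
      simp [Matrix.toLpLin_apply, Matrix.mulVec, dotProduct, hA, mul_comm]
    rw [e3]
    have e4 : ∑ i, c i • l i = ∑ i, (1/(d:ℝ)) • ((d * c i) • l i) := by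
      refine Finset.sum_congr rfl fun i _ => ?_
      rw [smul_smul]; congr 1; field_simp
    rw [e4]
    refine hc.sum_mem (fun _ _ => by positivity) (by simp; field_simp) fun i _ => ?_
    obtain ⟨c1, c2⟩ := hcc i
    refine hc.smul_mem_of_zero_mem h0 (hlL i) ⟨by positivity, ?_⟩
    rw [le_div_iff₀ hd0] at c2; linarith
  calc _ = ENNReal.ofReal (|A.det|⁻¹ * (1/(d:ℝ))^d) * ENNReal.ofReal (|A.det| * (1/(d:ℝ))^d) := by
        rw [← ENNReal.ofReal_mul (by positivity)]
        congr 1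
        field_simp
    _ ≤ _ := mul_le_mul' hV1 hV2

/-! ### Hilbert geometry -/

lemma mem_interior_of_polar {d : ℕ} {K : Set (Euc d)} (hK : IsClosed K) (hc : Convex ℝ K)
    {x v : Euc d} (hx : x ∈ interior K) (hv : ∀ w ∈ polarAt K x, |⟪v, w⟫| ≤ 1/2) :
    x + v ∈ interior K := by
  by_contra hcon
  obtain ⟨f, hf⟩ := geometric_hahn_banach_open_point hc.interior isOpen_interior hcon
  have hK' : K = closure (interior K) := by
    rw [hc.closure_interior_eq_closure_of_nonempty_interior ⟨x, hx⟩, hK.closure_eq]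
  have hf' : ∀ k ∈ K, f k ≤ f (x + v) := by
    intro k hk
    rw [hK'] at hk
    have : closure (interior K) ⊆ {k | f k ≤ f (x + v)} :=
      closure_minimal (fun a ha => (hf a ha).le) (isClosed_le f.continuous continuous_const)
    exact this hk
  have hpos : 0 < f v := by
    have := hf x hx
    rw [map_add] at this; linarith
  set w0 := (InnerProductSpace.toDual ℝ (Euc d)).symm f with hw0
  have hw0' : ∀ y, ⟪w0, y⟫ = f y := fun y => InnerProductSpace.toDual_symm_apply
  have hmem : (f v)⁻¹ • w0 ∈ polarAt K x := by
    intro k hk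
    rw [real_inner_smul_left, hw0', inv_mul_le_iff₀ hpos, map_sub]
    have := hf' k hk
    rw [map_add] at this; linarith
  have h := hv _ hmem
  rw [real_inner_smul_right, real_inner_comm, hw0', inv_mul_cancel₀ hpos.ne'] at h
  norm_num at h

lemma bddAbove_line {d : ℕ} {U : Set (Euc d)} (hb : Bornology.IsBounded U) (x : Euc d)
    {v : Euc d} (hv : v ≠ 0) : ∃ M : ℝ, ∀ t : ℝ, x + t • v ∈ U → |t| ≤ M := by
  obtain ⟨ρ, hρ⟩ := hb.exists_norm_le
  have hpos : 0 < ‖v‖ := norm_pos_iff.2 hv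
  refine ⟨(ρ + ‖x‖) / ‖v‖, fun t ht => ?_⟩
  rw [le_div_iff₀ hpos]
  have h1 := hρ _ ht
  have h2 : ‖t • v‖ ≤ ‖x + t • v‖ + ‖x‖ := by
    simpa using norm_sub_le (x + t • v) x
  rw [norm_smul, Real.norm_eq_abs] at h2
  linarith

lemma exists_lt_line {d : ℕ} {U : Set (Euc d)} (ho : IsOpen U) (x v : Euc d) (t0 : ℝ)
    (h : x + t0 • v ∈ U) : ∃ δ > 0, x + (t0 + δ) • v ∈ U ∧ x + (t0 - δ) • v ∈ U := by
  have hop : IsOpen ((fun t : ℝ => x + t • v) ⁻¹' U) := ho.preimage (by fun_prop)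
  obtain ⟨δ, hδ, hb⟩ := Metric.isOpen_iff.1 hop t0 h
  refine ⟨δ/2, by positivity, hb ?_, hb ?_⟩ <;>
    simp [abs_of_pos hδ] <;> linarith

lemma one_lt_sSup_line {d : ℕ} {U : Set (Euc d)} (ho : IsOpen U) (hb : Bornology.IsBounded U)
    (x : Euc d) {v : Euc d} (hv : v ≠ 0) (h : x + v ∈ U) :
    1 < sSup {t : ℝ | 0 < t ∧ x + t • v ∈ U} := by
  obtain ⟨M, hM⟩ := bddAbove_line hb x hv
  obtain ⟨δ, hδ, h1, -⟩ := exists_lt_line ho x v 1 (by simpa using h)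
  have : 1 + δ ≤ sSup {t : ℝ | 0 < t ∧ x + t • v ∈ U} :=
    le_csSup ⟨M, fun t ht => (le_abs_self t).trans (hM t ht.2)⟩ ⟨by positivity, h1⟩
  linarith

lemma mem_finslerUnitBall {d : ℕ} {U : Set (Euc d)} (ho : IsOpen U) (hb : Bornology.IsBounded U)
    {x v : Euc d} (h1 : x + v ∈ U) (h2 : x - v ∈ U) : v ∈ finslerUnitBall U x := by
  change finslerNorm U x v < 1
  unfold finslerNorm
  split_ifs with hv
  · norm_num
  have a1 := one_lt_sSup_line ho hb x hv h1
  have a2 := one_lt_sSup_line ho hb x (neg_ne_zero.2 hv) (by simpa [sub_eq_add_neg] using h2)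
  simp only [smul_neg, ← sub_eq_add_neg] at a2
  have b1 := (div_lt_one (zero_lt_one.trans a1)).2 a1
  have b2 := (div_lt_one (zero_lt_one.trans a2)).2 a2
  linarith

lemma ball_subset_of_mem_hilbertBall {d : ℕ} {K : Set (Euc d)} (hK : IsCompact K)
    (hc : Convex ℝ K) {p q : Euc d} {r R : ℝ} (hp : p ∈ interior K) (hr : 0 < r) (hR : 0 ≤ R)
    (hb : closedBall p r ⊆ K) (hq : q ∈ hilbertBall (interior K) p R) :
    closedBall q (Real.exp (-2 * R) * r) ⊆ K := by
  obtain ⟨hqU, hdist⟩ := hq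
  have hbd : Bornology.IsBounded (interior K) := hK.isBounded.subset interior_subset
  unfold hilbertDist at hdist
  split_ifs at hdist with hpq
  · subst hpq
    refine (closedBall_subset_closedBall ?_).trans hb
    have : Real.exp (-2 * R) ≤ 1 := Real.exp_le_one_iff.2 (by linarith)
    nlinarith
  have hv : q - p ≠ 0 := sub_ne_zero.2 (Ne.symm hpq)
  set I : Set ℝ := {t : ℝ | p + t • (q - p) ∈ interior K} with hI
  obtain ⟨M, hM⟩ := bddAbove_line hbd p hv
  have hba : BddAbove I := ⟨M, fun t ht => (le_abs_self t).trans (hM t ht)⟩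
  have hbb : BddBelow I := ⟨-M, fun t ht => (abs_le.1 (hM t ht)).1⟩
  have hb1 : 1 < sSup I := by
    obtain ⟨δ, hδ, h1, -⟩ := exists_lt_line isOpen_interior p (q - p) 1 (by simpa using hqU)
    have : 1 + δ ≤ sSup I := le_csSup hba h1
    linarith
  have ha0 : sInf I < 0 := by
    obtain ⟨δ, hδ, -, h1⟩ := exists_lt_line isOpen_interior p (q - p) 0 (by simpa using hp)
    have : sInf I ≤ 0 - δ := csInf_le hbb h1
    linarith
  have hbK : p + sSup I • (q - p) ∈ K := by
    have h1 : sSup I ∈ closure I := csSup_mem_closure ⟨1, by simpa [hI] using hqU⟩ hba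
    have h2 : I ⊆ (fun t : ℝ => p + t • (q - p)) ⁻¹' K := fun t ht =>
      show p + t • (q - p) ∈ K from interior_subset ht
    exact closure_minimal h2 (hK.isClosed.preimage (by fun_prop)) h1
  set a := sInf I
  set b := sSup I
  have hfac : 1 ≤ (1 - a) / (-a) := by rw [le_div_iff₀ (by linarith)]; linarith
  have hfac2 : 0 < b / (b - 1) := div_pos (by linarith) (by linarith)
  have hX : b / (b - 1) ≤ Real.exp (2 * R) := by
    refine le_trans (le_mul_of_one_le_left hfac2.le hfac) ?_
    rw [← Real.log_le_iff_le_exp (by positivity)]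
    linarith
  have hb0 : 0 < b := by linarith
  have hlam : Real.exp (-2 * R) ≤ 1 - 1/b := by
    rw [div_le_iff₀ (by linarith)] at hX
    have e1 : Real.exp (-2 * R) * Real.exp (2 * R) = 1 := by rw [← Real.exp_add]; simp
    have e2 : 1 - 1/b = (b-1)/b := by field_simp
    rw [e2, le_div_iff₀ hb0]
    calc Real.exp (-2 * R) * b ≤ Real.exp (-2 * R) * (Real.exp (2 * R) * (b-1)) := by gcongr
      _ = b - 1 := by rw [← mul_assoc, e1, one_mul]
  set lam := 1 - 1/b with hl
  have hlpos : 0 < lam := lt_of_lt_of_le (Real.exp_pos _) hlam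
  intro y hy
  rw [mem_closedBall, dist_eq_norm] at hy
  have hmem : p + lam⁻¹ • (y - q) ∈ K := by
    apply hb
    rw [mem_closedBall, dist_eq_norm, add_sub_cancel_left, norm_smul, norm_inv,
      Real.norm_of_nonneg hlpos.le, inv_mul_le_iff₀ hlpos]
    exact hy.trans (by gcongr)
  have := hc hbK hmem (a := 1/b) (b := lam) (by positivity) hlpos.le (by rw [hl]; ring)
  convert this using 1
  rw [smul_add, smul_add, smul_smul, smul_smul, one_div_mul_cancel hb0.ne',
    mul_inv_cancel₀ hlpos.ne', one_smul, one_smul, hl, sub_smul, one_smul]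
  abel

/-- Pointwise bound on the Busemann density. -/
lemma density_le {d : ℕ} (hd : 1 ≤ d) {K : Set (Euc d)} (hK : IsCompact K) (hc : Convex ℝ K)
    {x : Euc d} (hx : x ∈ interior K) :
    volume (Metric.ball (0 : Euc d) 1) / volume (finslerUnitBall (interior K) x) ≤
      (volume (Metric.ball (0 : Euc d) 1) / ENNReal.ofReal ((1 / (d:ℝ))^d * (1/(d:ℝ))^d)) *
        volume (polarAt K x) := by
  have hd0 : (0:ℝ) < d := by exact_mod_cast hd
  have hbd : Bornology.IsBounded (interior K) := hK.isBounded.subset interior_subset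
  set c := ENNReal.ofReal ((1 / (d:ℝ))^d * (1/(d:ℝ))^d) with hcdef
  have hc0 : c ≠ 0 := by
    rw [hcdef, Ne, ENNReal.ofReal_eq_zero, not_le]; positivity
  have hct : c ≠ ∞ := ENNReal.ofReal_ne_top
  obtain ⟨r, hr, hrb⟩ := Metric.nhds_basis_closedBall.mem_iff.1 (mem_interior_iff_mem_nhds.1 hx)
  have hcomp : IsCompact (polarAt K x) := by
    refine Metric.isCompact_of_isClosed_isBounded (isClosed_polarAt K x) ?_
    refine (Metric.isBounded_closedBall (x := (0 : Euc d)) (r := 1/r)).subset fun w hw => ?_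
    simpa using polarAt_norm_le hr hrb hw
  obtain ⟨ρ, hρ⟩ := hK.isBounded.exists_norm_le
  have hρ0 : 0 ≤ ρ := (norm_nonneg _).trans (hρ x (interior_subset hx))
  have hball : closedBall (0 : Euc d) (1/(2*ρ+1)) ⊆ polarAt K x := by
    intro w hw k hk
    have h1 : ‖w‖ ≤ 1/(2*ρ+1) := by simpa using hw
    have h2 : ‖k - x‖ ≤ 2*ρ+1 := by
      have := norm_sub_le k x
      have := hρ k hk
      have := hρ x (interior_subset hx)
      linarith
    calc ⟪w, k - x⟫ ≤ ‖w‖ * ‖k - x‖ := real_inner_le_norm _ _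
      _ ≤ 1/(2*ρ+1) * (2*ρ+1) := by gcongr
      _ = 1 := by field_simp
  have hprod := exists_auerbach hd (polarAt K x) hcomp (convex_polarAt K x) (zero_mem_polarAt K x)
    (1/(2*ρ+1)) (by positivity) hball
  have hsub : {v : Euc d | ∀ w ∈ polarAt K x, |⟪v, w⟫| ≤ 1/2} ⊆
      finslerUnitBall (interior K) x := by
    intro v hv
    refine mem_finslerUnitBall isOpen_interior hbd (mem_interior_of_polar hK.isClosed hc hx hv) ?_
    rw [sub_eq_add_neg]
    refine mem_interior_of_polar hK.isClosed hc hx fun w hw => ?_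
    rw [inner_neg_left, abs_neg]
    exact hv w hw
  have hprod' : c ≤ volume (polarAt K x) * volume (finslerUnitBall (interior K) x) := by
    rw [mul_comm]
    exact hprod.trans (mul_le_mul_left (measure_mono hsub) _)
  apply ENNReal.div_le_of_le_mul
  rw [mul_assoc]
  calc volume (Metric.ball (0 : Euc d) 1)
      = volume (Metric.ball (0 : Euc d) 1) / c * c := (ENNReal.div_mul_cancel hc0 hct).symm
    _ ≤ _ := mul_le_mul_right hprod' _

lemma busemann_bound {e : ℕ} {K : Set (Euc (e+1))} (hK : IsCompact K) (hc : Convex ℝ K)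
    {p : Euc (e+1)} (hp : p ∈ interior K) :
    ∃ C : ℝ, 1 ≤ C ∧ ∃ m : ℕ, ∀ n : ℕ,
      busemannVol (interior K) (hilbertBall (interior K) p (n * Real.log 2)) ≤
        ENNReal.ofReal (C * ((n + m : ℕ) + 1) * (2^(n+m))^e) := by
  obtain ⟨r, hr, hrb⟩ := Metric.nhds_basis_closedBall.mem_iff.1 (mem_interior_iff_mem_nhds.1 hp)
  obtain ⟨C, hC, hvol⟩ := phaseBody_vol K hK hc
  obtain ⟨m0, hm0⟩ := pow_unbounded_of_one_lt (1/r) (by norm_num : (1:ℝ) < 4)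
  set m := m0 + 3
  have hm : 1/r ≤ (4:ℝ)^m := hm0.le.trans (pow_le_pow_right₀ (by norm_num) (by omega))
  set c := volume (Metric.ball (0 : Euc (e+1)) 1) /
    ENNReal.ofReal ((1 / ((e+1 : ℕ):ℝ))^(e+1) * (1/((e+1 : ℕ):ℝ))^(e+1)) with hcdef
  have hct : c ≠ ∞ := by
    refine (ENNReal.div_lt_top measure_ball_lt_top.ne ?_).ne
    rw [Ne, ENNReal.ofReal_eq_zero, not_le]; positivity
  refine ⟨(c.toReal + 1) * C, ?_, m, fun n => ?_⟩
  · have := ENNReal.toReal_nonneg (a := c)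
    nlinarith
  have hmeas : MeasurableSet (phaseBody K (4^(n+m))) := (isClosed_phaseBody hK.isClosed _).measurableSet
  have hmf : Measurable fun x => c * volume (Prod.mk x ⁻¹' phaseBody K (4^(n+m))) :=
    (measurable_measure_prodMk_left hmeas).const_mul c
  have hlog : 0 ≤ Real.log 2 := Real.log_nonneg (by norm_num)
  have hexp : Real.exp (-2 * (n * Real.log 2)) = ((4:ℝ)^n)⁻¹ := by
    have : -2 * (n * Real.log 2) = -(n * (Real.log 2 + Real.log 2)) := by ring
    rw [this, Real.exp_neg, Real.exp_nat_mul, Real.exp_add, Real.exp_log (by norm_num)]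
    norm_num
  calc busemannVol (interior K) (hilbertBall (interior K) p (n * Real.log 2))
      ≤ ∫⁻ x in hilbertBall (interior K) p (n * Real.log 2),
          c * volume (Prod.mk x ⁻¹' phaseBody K (4^(n+m))) := by
        refine setLIntegral_mono hmf fun x hx => ?_
        refine (density_le (by omega) hK hc hx.1).trans ?_
        refine mul_le_mul_right (measure_mono fun w hw => ?_) _
        refine ⟨interior_subset hx.1, ?_, hw⟩
        have hbq := ball_subset_of_mem_hilbertBall hK hc hp hr (by positivity) hrb hx
        have := polarAt_norm_le (by positivity) hbq hw
        refine this.trans ?_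
        rw [hexp, one_div, mul_inv, inv_inv, pow_add, ← one_div]
        gcongr
    _ ≤ ∫⁻ x, c * volume (Prod.mk x ⁻¹' phaseBody K (4^(n+m))) := setLIntegral_le_lintegral _ _
    _ = c * volume (phaseBody K (4^(n+m))) := by
        rw [lintegral_const_mul _ (measurable_measure_prodMk_left hmeas), Measure.volume_eq_prod,
          Measure.prod_apply hmeas]
    _ ≤ ENNReal.ofReal (c.toReal + 1) * ENNReal.ofReal (C * ((n + m : ℕ) + 1) * (2^(n+m))^e) := by
        refine mul_le_mul' ?_ (hvol (n+m) (by omega))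
        rw [← ENNReal.ofReal_toReal hct]
        apply ENNReal.ofReal_le_ofReal
        simp
    _ = _ := by
        rw [← ENNReal.ofReal_mul (by positivity)]
        congr 1; ring

lemma rate_tendsto (C : ℝ) (m e : ℕ) :
    Tendsto (fun n : ℕ => (Real.log C + Real.log ((n + m : ℕ) + 1) +
      ((n + m : ℕ) * e : ℝ) * Real.log 2) / (n * Real.log 2)) atTop (𝓝 (e : ℝ)) := by
  have hlog : 0 < Real.log 2 := Real.log_pos (by norm_num)
  have hR : Tendsto (fun n : ℕ => (n : ℝ) * Real.log 2) atTop atTop :=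
    tendsto_natCast_atTop_atTop.atTop_mul_const hlog
  have h1 : Tendsto (fun n : ℕ => (Real.log C + m * e * Real.log 2) / (n * Real.log 2))
      atTop (𝓝 0) := hR.const_div_atTop _
  have hx : Tendsto (fun n : ℕ => ((n + m : ℕ) : ℝ) + 1) atTop atTop :=
    tendsto_atTop_add_const_right _ _
      (tendsto_natCast_atTop_atTop.comp (tendsto_add_atTop_nat m))
  have h2 := (Real.tendsto_pow_log_div_mul_add_atTop (Real.log 2) (-((m + 1) * Real.log 2)) 1
    hlog.ne').comp hx
  have h3 := (h1.add h2).add_const (e : ℝ)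
  simp only [add_zero, zero_add] at h3
  refine h3.congr' ?_
  filter_upwards [eventually_ge_atTop 1] with n hn
  have hn0 : (0:ℝ) < n := by exact_mod_cast hn
  have e1 : Real.log 2 * (((n + m : ℕ) : ℝ) + 1) + -((m + 1) * Real.log 2) = n * Real.log 2 := by
    push_cast; ring
  simp only [Function.comp, e1, pow_one]
  push_cast
  field_simp
  ring

/-- For a convex body `Ω ⊆ ℝ^d` (`d ≥ 1`) and any base point `p ∈ int Ω`,
the volume entropy of the Hilbert geometry on `Ω` is at most `d - 1`. -/
theorem entropy_le (d : ℕ) (hd : 1 ≤ d) (Ω : Set (Euc d))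
    (hcomp : IsCompact Ω) (hconv : Convex ℝ Ω) (hint : (interior Ω).Nonempty) :
    ∀ p ∈ interior Ω,
      liminf (fun R : ℝ =>
          Real.log ((busemannVol (interior Ω) (hilbertBall (interior Ω) p R)).toReal) / R)
        atTop
      ≤ (d : ℝ) - 1 := by
  intro p hp
  obtain ⟨e, rfl⟩ : ∃ e, d = e + 1 := ⟨d - 1, by omega⟩
  obtain ⟨C, hC, m, hbound⟩ := busemann_bound hcomp hconv hp
  have hd1 : (((e + 1 : ℕ) : ℝ)) - 1 = e := by push_cast; ring
  rw [hd1, Filter.liminf_eq]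
  refine Real.sSup_le (fun a ha => ?_) (by positivity)
  have hlog : 0 < Real.log 2 := Real.log_pos (by norm_num)
  have hR : Tendsto (fun n : ℕ => (n : ℝ) * Real.log 2) atTop atTop :=
    tendsto_natCast_atTop_atTop.atTop_mul_const hlog
  refine ge_of_tendsto (rate_tendsto C m e) ?_
  filter_upwards [hR.eventually ha, eventually_ge_atTop 1] with n hn hn1
  refine hn.trans ?_
  have hn0 : (0:ℝ) < n := by exact_mod_cast hn1
  refine div_le_div_of_nonneg_right ?_ (by positivity)
  have h2 : (1:ℝ) ≤ (2^(n+m))^e := one_le_pow₀ (one_le_pow₀ (by norm_num))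
  have h3 : (1:ℝ) ≤ ((n + m : ℕ) : ℝ) + 1 := by
    have : (0:ℝ) ≤ ((n + m : ℕ) : ℝ) := by positivity
    linarith
  have h4 : (1:ℝ) ≤ C * (((n + m : ℕ) : ℝ) + 1) * (2^(n+m))^e :=
    one_le_mul_of_one_le_of_one_le (one_le_mul_of_one_le_of_one_le hC h3) h2
  have h5 : Real.log C + Real.log ((n + m : ℕ) + 1) + ((n + m : ℕ) * e : ℝ) * Real.log 2 =
      Real.log (C * (((n + m : ℕ) : ℝ) + 1) * (2^(n+m))^e) := by
    rw [Real.log_mul (by positivity) (by positivity), Real.log_mul (by positivity) (by positivity),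
      Real.log_pow, Real.log_pow]
    ring
  rw [h5]
  have h6 := ENNReal.toReal_le_of_le_ofReal (by positivity) (hbound n)
  rcases (ENNReal.toReal_nonneg (a := busemannVol (interior Ω)
    (hilbertBall (interior Ω) p (n * Real.log 2)))).eq_or_lt with h0 | h0
  · rw [← h0, Real.log_zero]
    exact Real.log_nonneg h4
  · exact Real.log_le_log h0 h6

end
end
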